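/- Let κ satisfy the energy, consistency, and domination principles, and assume (A1) and (A2). Then there exists a countable family Λ° of signed measures of finite energy, depending only on X and κ, such that for every set A ⊂ X and every μ ∈ E⁺: the inner balayage μ^A satisfies κ(μ^A, λ) = κ(λ^A, μ) for all λ ∈ Λ°, and these relations determine μ^A uniquely; that is, if ξ ∈ E⁺ satisfies κ(ξ, λ) = κ(λ^A, μ) for all λ ∈ Λ°, then ξ = μ^A. If A = B is Borel, the same holds with μ^A and λ^A replaced by the outer balayages μ^{*B} and λ^{*B}. -/

import Mathlib

open MeasureTheory Filter Topology Set
open scoped ENNReal NNReal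

namespace Balayage

variable {X : Type*} [TopologicalSpace X] [T2Space X] [LocallyCompactSpace X]
  [MeasurableSpace X] [BorelSpace X]

/-- The potential `κμ(x) := ∫ κ(x,y) dμ(y)`. -/
noncomputable def pot (κ : X → X → ℝ≥0∞) (μ : Measure X) (x : X) : ℝ≥0∞ :=
  ∫⁻ y, κ x y ∂μ

/-- The mutual energy `κ(μ,ν) := ∬ κ(x,y) d(μ⊗ν)(x,y)`. -/
noncomputable def energy (κ : X → X → ℝ≥0∞) (μ ν : Measure X) : ℝ≥0∞ :=
  ∫⁻ x, pot κ ν x ∂μ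

/-- A positive Radon measure: locally finite and inner regular. -/
def IsRadon (μ : Measure X) : Prop :=
  μ.InnerRegular ∧ IsLocallyFiniteMeasure μ

/-- `E⁺`: the positive Radon measures of finite energy. -/
def Eplus (κ : X → X → ℝ≥0∞) : Set (Measure X) :=
  {μ | IsRadon μ ∧ energy κ μ μ < ⊤}

/-- `μ` is concentrated on `A`: `A` is `μ`-measurable and `X∖A` is locally `μ`-negligible. -/
def ConcOn (μ : Measure X) (A : Set X) : Prop :=
  NullMeasurableSet A μ ∧ ∀ K : Set X, IsCompact K → μ (Aᶜ ∩ K) = 0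

/-- `E⁺_A`: measures of finite energy concentrated on `A`. -/
def EplusOn (κ : X → X → ℝ≥0∞) (A : Set X) : Set (Measure X) :=
  {μ ∈ Eplus κ | ConcOn μ A}

/-- The inner capacity `c_*(A)`. -/
noncomputable def innerCap (κ : X → X → ℝ≥0∞) (A : Set X) : ℝ≥0∞ :=
  (⨅ μ ∈ {μ ∈ EplusOn κ A | μ Set.univ = 1}, energy κ μ μ)⁻¹

/-- `P` holds nearly everywhere on `A`: the set where it fails has inner capacity zero. -/
def NEOn (κ : X → X → ℝ≥0∞) (A : Set X) (P : X → Prop) : Prop :=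
  innerCap κ {x | x ∈ A ∧ ¬ P x} = 0

/-- The outer capacity `c^*(A)`. -/
noncomputable def outerCap (κ : X → X → ℝ≥0∞) (A : Set X) : ℝ≥0∞ :=
  ⨅ D ∈ {D : Set X | IsOpen D ∧ A ⊆ D}, innerCap κ D

/-- `P` holds quasi-everywhere on `A`: the set where it fails has outer capacity zero. -/
def QEOn (κ : X → X → ℝ≥0∞) (A : Set X) (P : X → Prop) : Prop :=
  outerCap κ {x | x ∈ A ∧ ¬ P x} = 0

/-- The class `Λ_{A,μ}` of measures `ν ∈ E⁺` with `κν ≥ κμ` n.e. on `A`. -/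
def InnerLam (κ : X → X → ℝ≥0∞) (A : Set X) (μ : Measure X) : Set (Measure X) :=
  {ν ∈ Eplus κ | NEOn κ A (fun x => pot κ μ x ≤ pot κ ν x)}

/-- The class `Λ*_{A,μ}` of measures `ν ∈ E⁺` with `κν ≥ κμ` q.e. on `A`. -/
def OuterLam (κ : X → X → ℝ≥0∞) (A : Set X) (μ : Measure X) : Set (Measure X) :=
  {ν ∈ Eplus κ | QEOn κ A (fun x => pot κ μ x ≤ pot κ ν x)}

/-- `b` is the inner balayage `μ^A`: the measure of minimal potential in `Λ_{A,μ}`. -/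
def IsInnerBal (κ : X → X → ℝ≥0∞) (A : Set X) (μ b : Measure X) : Prop :=
  b ∈ InnerLam κ A μ ∧ ∀ ν ∈ InnerLam κ A μ, ∀ x, pot κ b x ≤ pot κ ν x

/-- `b` is the outer balayage `μ^{*A}`: the measure of minimal potential in `Λ*_{A,μ}`. -/
def IsOuterBal (κ : X → X → ℝ≥0∞) (A : Set X) (μ b : Measure X) : Prop :=
  b ∈ OuterLam κ A μ ∧ ∀ ν ∈ OuterLam κ A μ, ∀ x, pot κ b x ≤ pot κ ν x

/-- The strong (energy) distance `‖μ − ν‖`. -/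
noncomputable def strDist (κ : X → X → ℝ≥0∞) (μ ν : Measure X) : ℝ :=
  Real.sqrt ((energy κ μ μ).toReal - 2 * (energy κ μ ν).toReal + (energy κ ν ν).toReal)

/-- The energy principle (strict positive definiteness). -/
def EnergyPrinciple (κ : X → X → ℝ≥0∞) : Prop :=
  ∀ μ ∈ Eplus κ, ∀ ν ∈ Eplus κ,
    2 * energy κ μ ν ≤ energy κ μ μ + energy κ ν ν ∧
      (2 * energy κ μ ν = energy κ μ μ + energy κ ν ν → μ = ν)

/-- Vague convergence of a net of measures along a filter. -/
def VagueConv {ι : Type*} (F : Filter ι) (m : ι → Measure X) (ν : Measure X) : Prop :=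
  ∀ f : X → ℝ, Continuous f → HasCompactSupport f →
    Tendsto (fun i => ∫ x, f x ∂(m i)) F (nhds (∫ x, f x ∂ν))

/-- A net of measures is strong Cauchy (for the energy metric) along a filter. -/
def StrongCauchy (κ : X → X → ℝ≥0∞) {ι : Type*} (F : Filter ι) (m : ι → Measure X) : Prop :=
  ∀ ε : ℝ, 0 < ε → ∃ s ∈ F, ∀ i ∈ s, ∀ j ∈ s, strDist κ (m i) (m j) < ε

/-- The consistency principle: every strong Cauchy net in `E⁺` converges strongly
to each of its vague limit points. -/
def Consistent (κ : X → X → ℝ≥0∞) : Prop :=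
  ∀ (ι : Type) (F : Filter ι) (m : ι → Measure X), F.NeBot →
    (∀ i, m i ∈ Eplus κ) → StrongCauchy κ F m →
    ∀ ν : Measure X, (∃ G : Filter ι, G ≤ F ∧ G.NeBot ∧ VagueConv G m ν) →
      Tendsto (fun i => strDist κ (m i) ν) F (nhds 0)

/-- The domination principle. -/
def Domination (κ : X → X → ℝ≥0∞) : Prop :=
  ∀ μ ∈ Eplus κ, ∀ ν ∈ Eplus κ,
    (∀ᵐ x ∂μ, pot κ μ x ≤ pot κ ν x) → ∀ x, pot κ μ x ≤ pot κ ν x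

/-- A kernel: symmetric and lower semicontinuous. -/
structure IsKernel (κ : X → X → ℝ≥0∞) : Prop where
  symm : ∀ x y, κ x y = κ y x
  lsc : LowerSemicontinuous (Function.uncurry κ)

/-- `E'_A`: the strong closure of `E⁺_A` within `E⁺`. -/
def EclosOn (κ : X → X → ℝ≥0∞) (A : Set X) : Set (Measure X) :=
  {ν ∈ Eplus κ | ∀ ε : ℝ, 0 < ε → ∃ μ ∈ EplusOn κ A, strDist κ ν μ < ε}

/-- The (real-valued) potential of the signed measure `λ = lp − lm`. -/
noncomputable def spot (κ : X → X → ℝ≥0∞) (lp lm : Measure X) (x : X) : ℝ :=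
  (pot κ lp x).toReal - (pot κ lm x).toReal

/-- Assumption (A2): every `f ∈ C_c(X)` is the limit, uniformly with supports in one fixed
compact set, of a sequence of potentials of signed measures of finite energy that are
continuous and compactly supported. -/
def A2 (κ : X → X → ℝ≥0∞) : Prop :=
  ∀ f : X → ℝ, Continuous f → HasCompactSupport f →
    ∃ (K : Set X) (lp lm : ℕ → Measure X), IsCompact K ∧ tsupport f ⊆ K ∧
      (∀ j, lp j ∈ Eplus κ ∧ lm j ∈ Eplus κ) ∧
      (∀ j x, pot κ (lp j) x ≠ ⊤ ∨ pot κ (lm j) x ≠ ⊤) ∧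
      (∀ j, Continuous (spot κ (lp j) (lm j))) ∧
      (∀ j, tsupport (spot κ (lp j) (lm j)) ⊆ K) ∧
      TendstoUniformly (fun j => spot κ (lp j) (lm j)) f atTop


set_option linter.unusedSectionVars false

section Basics

variable [SecondCountableTopology X] {κ : X → X → ℝ≥0∞} {μ ν σ τ : Measure X}

lemma isRadon_iff : IsRadon μ ↔ IsLocallyFiniteMeasure μ := by
  refine ⟨fun h => h.2, fun h => ⟨?_, h⟩⟩
  let := TopologicalSpace.metrizableSpaceMetric X
  infer_instance

lemma IsKernel.measurable_uncurry (hk : IsKernel κ) : Measurable (Function.uncurry κ) :=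
  hk.lsc.measurable

lemma IsKernel.measurable_pot (hk : IsKernel κ) (μ : Measure X) [SFinite μ] :
    Measurable (pot κ μ) :=
  hk.measurable_uncurry.lintegral_prod_right'

lemma energy_comm (hk : IsKernel κ) (μ ν : Measure X) [SFinite μ] [SFinite ν] :
    energy κ μ ν = energy κ ν μ := by
  unfold energy pot
  rw [lintegral_lintegral_swap hk.measurable_uncurry.aemeasurable]
  simp_rw [hk.symm]

lemma pot_add (μ ν : Measure X) (x : X) : pot κ (μ + ν) x = pot κ μ x + pot κ ν x :=
  lintegral_add_measure _ _ _

lemma pot_smul (c : ℝ≥0) (μ : Measure X) (x : X) : pot κ (c • μ) x = c * pot κ μ x := by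
  unfold pot
  rw [lintegral_smul_measure]
  rfl

lemma energy_add_left (μ ν σ : Measure X) :
    energy κ (μ + ν) σ = energy κ μ σ + energy κ ν σ :=
  lintegral_add_measure _ _ _

lemma energy_smul_left (c : ℝ≥0) (μ σ : Measure X) :
    energy κ (c • μ) σ = c * energy κ μ σ := by
  unfold energy
  rw [lintegral_smul_measure]
  rfl

lemma energy_add_right (hk : IsKernel κ) (σ μ ν : Measure X) [SFinite μ] :
    energy κ σ (μ + ν) = energy κ σ μ + energy κ σ ν := by
  unfold energy
  simp_rw [pot_add]
  exact lintegral_add_left (hk.measurable_pot μ) _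

lemma energy_smul_right (c : ℝ≥0) (σ μ : Measure X) :
    energy κ σ (c • μ) = c * energy κ σ μ := by
  unfold energy
  simp_rw [pot_smul]
  exact lintegral_const_mul' _ _ ENNReal.coe_ne_top

/-- The mutual energy as a real number. -/
noncomputable def renergy (κ : X → X → ℝ≥0∞) (μ ν : Measure X) : ℝ := (energy κ μ ν).toReal

/-- The squared energy distance. -/
noncomputable def dist2 (κ : X → X → ℝ≥0∞) (μ ν : Measure X) : ℝ :=
  renergy κ μ μ - 2 * renergy κ μ ν + renergy κ ν ν

/-- A kernel satisfying all principles, in the form in which they are used. -/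
structure Admissible (κ : X → X → ℝ≥0∞) : Prop where
  ker : IsKernel κ
  ener : EnergyPrinciple κ
  cons : Consistent κ
  dom : Domination κ
  one_le : ∀ K : Set X, IsCompact K → ∃ μ ∈ Eplus κ, ∀ x ∈ K, 1 ≤ pot κ μ x

lemma zero_mem_Eplus : (0 : Measure X) ∈ Eplus κ :=
  ⟨isRadon_iff.2 inferInstance, by simp [energy]⟩

namespace Admissible

variable (hκ : Admissible κ)
include hκ

lemma energy_lt_top (hμ : μ ∈ Eplus κ) (hν : ν ∈ Eplus κ) : energy κ μ ν < ⊤ := by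
  have h := (hκ.ener μ hμ ν hν).1
  have h2 : 2 * energy κ μ ν < ⊤ := h.trans_lt (ENNReal.add_lt_top.2 ⟨hμ.2, hν.2⟩)
  refine lt_of_le_of_lt ?_ h2
  calc energy κ μ ν = 1 * energy κ μ ν := (one_mul _).symm
    _ ≤ _ := by gcongr; norm_num

lemma comm (hμ : μ ∈ Eplus κ) (hν : ν ∈ Eplus κ) : renergy κ μ ν = renergy κ ν μ := by
  have := hμ.1.2
  have := hν.1.2
  rw [renergy, energy_comm hκ.ker]
  rfl

lemma add_mem (hμ : μ ∈ Eplus κ) (hν : ν ∈ Eplus κ) : μ + ν ∈ Eplus κ := by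
  have h1 := hμ.1.2
  have h2 := hν.1.2
  refine ⟨isRadon_iff.2 ⟨fun x => ?_⟩, ?_⟩
  · obtain ⟨s, hs, hs'⟩ := h1.1 x
    obtain ⟨t, ht, ht'⟩ := h2.1 x
    refine ⟨s ∩ t, inter_mem hs ht, ?_⟩
    rw [Measure.add_apply]
    exact ENNReal.add_lt_top.2 ⟨(measure_mono inter_subset_left).trans_lt hs',
      (measure_mono inter_subset_right).trans_lt ht'⟩
  · rw [energy_add_left, energy_add_right hκ.ker, energy_add_right hκ.ker]
    simp [ENNReal.add_lt_top, hκ.energy_lt_top, hμ, hν]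

omit hκ in
lemma smul_mem (c : ℝ≥0) (hμ : μ ∈ Eplus κ) : c • μ ∈ Eplus κ := by
  have h1 := hμ.1.2
  refine ⟨isRadon_iff.2 inferInstance, ?_⟩
  rw [energy_smul_left, energy_smul_right]
  exact ENNReal.mul_lt_top ENNReal.coe_lt_top (ENNReal.mul_lt_top ENNReal.coe_lt_top hμ.2)

omit hκ in
lemma mono_mem (hμ : μ ∈ Eplus κ) (h : ν ≤ μ) : ν ∈ Eplus κ := by
  have h1 := hμ.1.2
  refine ⟨isRadon_iff.2 (Measure.isLocallyFiniteMeasure_of_le h), lt_of_le_of_lt ?_ hμ.2⟩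
  exact lintegral_mono' h fun x => lintegral_mono' h le_rfl

lemma add_left (hμ : μ ∈ Eplus κ) (hν : ν ∈ Eplus κ) (hσ : σ ∈ Eplus κ) :
    renergy κ (μ + ν) σ = renergy κ μ σ + renergy κ ν σ := by
  rw [renergy, energy_add_left, ENNReal.toReal_add (hκ.energy_lt_top hμ hσ).ne
    (hκ.energy_lt_top hν hσ).ne]
  rfl

lemma add_right (hμ : μ ∈ Eplus κ) (hν : ν ∈ Eplus κ) (hσ : σ ∈ Eplus κ) :
    renergy κ σ (μ + ν) = renergy κ σ μ + renergy κ σ ν := by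
  rw [hκ.comm hσ (hκ.add_mem hμ hν), hκ.add_left hμ hν hσ, hκ.comm hμ hσ, hκ.comm hν hσ]

omit hκ in
lemma smul_left (c : ℝ≥0) (μ σ : Measure X) : renergy κ (c • μ) σ = c * renergy κ μ σ := by
  rw [renergy, energy_smul_left, ENNReal.toReal_mul]
  rfl

omit hκ in
lemma smul_right (c : ℝ≥0) (μ σ : Measure X) : renergy κ σ (c • μ) = c * renergy κ σ μ := by
  rw [renergy, energy_smul_right, ENNReal.toReal_mul]
  rfl

lemma dist2_nonneg (hμ : μ ∈ Eplus κ) (hν : ν ∈ Eplus κ) : 0 ≤ dist2 κ μ ν := by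
  have h := (hκ.ener μ hμ ν hν).1
  have h' := ENNReal.toReal_mono (ENNReal.add_lt_top.2 ⟨hμ.2, hν.2⟩).ne h
  rw [ENNReal.toReal_mul, ENNReal.toReal_add hμ.2.ne hν.2.ne, ENNReal.toReal_ofNat] at h'
  unfold dist2 renergy
  linarith

lemma eq_of_dist2_eq_zero (hμ : μ ∈ Eplus κ) (hν : ν ∈ Eplus κ) (h : dist2 κ μ ν = 0) :
    μ = ν := by
  refine (hκ.ener μ hμ ν hν).2 ?_
  rw [← ENNReal.toReal_eq_toReal_iff' (ENNReal.mul_lt_top (by simp) (hκ.energy_lt_top hμ hν)).ne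
    (ENNReal.add_lt_top.2 ⟨hμ.2, hν.2⟩).ne, ENNReal.toReal_mul, ENNReal.toReal_add hμ.2.ne hν.2.ne,
    ENNReal.toReal_ofNat]
  unfold dist2 renergy at h
  linarith

omit hκ in
lemma renergy_nonneg (μ ν : Measure X) : 0 ≤ renergy κ μ ν := ENNReal.toReal_nonneg

/-- Cauchy–Schwarz in additive form. -/
lemma abs_sub_le (hμ : μ ∈ Eplus κ) (hν : ν ∈ Eplus κ) (hσ : σ ∈ Eplus κ) :
    |renergy κ σ μ - renergy κ σ ν| ≤ Real.sqrt (dist2 κ μ ν) * (renergy κ σ σ + 1) := by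
  have hd0 : 0 ≤ Real.sqrt (dist2 κ μ ν) := Real.sqrt_nonneg _
  have hdd : Real.sqrt (dist2 κ μ ν) ^ 2 = dist2 κ μ ν := Real.sq_sqrt (hκ.dist2_nonneg hμ hν)
  generalize Real.sqrt (dist2 κ μ ν) = d at hd0 hdd ⊢
  rcases hd0.eq_or_lt with h0 | h0
  · have : μ = ν := hκ.eq_of_dist2_eq_zero hμ hν (by rw [← hdd, ← h0]; simp)
    rw [this, ← h0]
    simp
  lift d to ℝ≥0 using hd0
  have hdσ := smul_mem d hσ
  have key1 := hκ.dist2_nonneg (hκ.add_mem hμ hdσ) hν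
  have key2 := hκ.dist2_nonneg hμ (hκ.add_mem hν hdσ)
  have aux : dist2 κ μ ν = renergy κ μ μ - 2 * renergy κ μ ν + renergy κ ν ν := rfl
  unfold dist2 at key1 key2
  rw [hκ.add_left hμ hdσ (hκ.add_mem hμ hdσ), hκ.add_left hμ hdσ hν,
    hκ.add_right hμ hdσ hμ, hκ.add_right hμ hdσ hdσ] at key1
  rw [hκ.add_left hν hdσ (hκ.add_mem hν hdσ), hκ.add_right hν hdσ hμ,
    hκ.add_right hν hdσ hν, hκ.add_right hν hdσ hdσ] at key2
  simp only [smul_left, smul_right] at key1 key2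
  rw [hκ.comm hμ hσ] at key1 key2
  rw [hκ.comm hν hσ] at key2
  have hs := renergy_nonneg (κ := κ) σ σ
  rw [abs_le]
  constructor
  · by_contra! hcon
    have := mul_lt_mul_of_pos_left hcon h0
    nlinarith
  · by_contra! hcon
    have := mul_lt_mul_of_pos_left hcon h0
    nlinarith

lemma cauchy_schwarz (hμ : μ ∈ Eplus κ) (hν : ν ∈ Eplus κ) :
    renergy κ μ ν ^ 2 ≤ renergy κ μ μ * renergy κ ν ν := by
  have h : ∀ s t : ℝ≥0, 0 ≤ (s : ℝ) ^ 2 * renergy κ μ μ - 2 * (s * t) * renergy κ μ ν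
      + (t : ℝ) ^ 2 * renergy κ ν ν := by
    intro s t
    have := hκ.dist2_nonneg (smul_mem s hμ) (smul_mem t hν)
    simp only [dist2, smul_left, smul_right] at this
    nlinarith
  have a0 := renergy_nonneg (κ := κ) μ μ
  have b0 := renergy_nonneg (κ := κ) ν ν
  have c0 := renergy_nonneg (κ := κ) μ ν
  generalize renergy κ μ μ = a at *
  generalize renergy κ ν ν = b at *
  generalize renergy κ μ ν = c at *
  lift c to ℝ≥0 using c0
  lift b to ℝ≥0 using b0
  lift a to ℝ≥0 using a0
  rcases eq_or_ne b 0 with rfl | hb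
  · have h1 := h 1 (a + 1)
    have h2 := h c (a + 1)
    push_cast at h1 h2 ⊢
    by_contra! hcon
    have hc : (0 : ℝ) < c := by
      rcases c.coe_nonneg.eq_or_lt with h | h
      · rw [← h] at hcon; simp at hcon
      · exact h
    have ha := a.coe_nonneg
    nlinarith [mul_pos hc hc, h c (a + 1)]
  · have hb' : (0 : ℝ) < b := by positivity
    have := h b c
    have h3 : 0 ≤ (b : ℝ) * (a * b - c ^ 2) := by nlinarith
    linarith [nonneg_of_mul_nonneg_right h3 hb']

end Admissible

end Basics

section Vague

variable [SecondCountableTopology X] {κ : X → X → ℝ≥0∞}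

lemma lintegral_le_of_vagueConv {ι : Type*} {G : Filter ι} [G.NeBot] {m : ι → Measure X}
    {P : Measure X} [IsLocallyFiniteMeasure P] (hm : ∀ i, IsLocallyFiniteMeasure (m i))
    (h : VagueConv G m P) {g : X → ℝ≥0∞} (hg : LowerSemicontinuous g) {C : ℝ≥0∞}
    (hC : ∀ᶠ i in G, ∫⁻ x, g x ∂(m i) ≤ C) : ∫⁻ x, g x ∂P ≤ C := by
  let := TopologicalSpace.metrizableSpaceMetric X
  let hh : ℕ → X → ℝ≥0∞ := fun n x => ⨅ w, (min (g w) n + n * edist x w)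
  have hh_le : ∀ n x, hh n x ≤ min (g x) n := fun n x =>
    (iInf_le _ x).trans (by simp)
  have hh_ne : ∀ n x, hh n x ≠ ⊤ := fun n x =>
    (((hh_le n x).trans (min_le_right _ _)).trans_lt (ENNReal.natCast_lt_top n)).ne
  have hh_cont : ∀ n, Continuous (hh n) := by
    intro n
    refine continuous_of_le_add_edist n (ENNReal.natCast_ne_top n) fun x y => ?_
    rw [ENNReal.iInf_add]
    refine le_iInf fun w => (iInf_le _ w).trans ?_
    rw [add_assoc, ← mul_add]
    gcongr
    rw [add_comm]
    exact edist_triangle x y w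
  let K := CompactExhaustion.choice X
  choose χ hχ1 _ hχc hχr using fun n => exists_continuous_one_zero_of_isCompact (K.isCompact n)
    isClosed_empty (disjoint_empty (K n))
  let f : ℕ → X → ℝ := fun n x => χ n x * (hh n x).toReal
  have hf_cont : ∀ n, Continuous (f n) := fun n =>
    (χ n).continuous.mul ((ENNReal.continuousOn_toReal.comp_continuous (hh_cont n))
      fun x => hh_ne n x)
  have hf_supp : ∀ n, HasCompactSupport (f n) := fun n => (hχc n).mul_right
  have hf0 : ∀ n x, 0 ≤ f n x := fun n x => mul_nonneg (hχr n x).1 ENNReal.toReal_nonneg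
  have hf_le : ∀ n x, ENNReal.ofReal (f n x) ≤ g x := by
    intro n x
    calc ENNReal.ofReal (f n x) ≤ ENNReal.ofReal (1 * (hh n x).toReal) := by
          apply ENNReal.ofReal_le_ofReal
          exact mul_le_mul_of_nonneg_right (hχr n x).2 ENNReal.toReal_nonneg
      _ = hh n x := by rw [one_mul, ENNReal.ofReal_toReal (hh_ne n x)]
      _ ≤ g x := (hh_le n x).trans (min_le_left _ _)
  have hint : ∀ (μ : Measure X) [IsLocallyFiniteMeasure μ] (n : ℕ),
      ENNReal.ofReal (∫ x, f n x ∂μ) = ∫⁻ x, ENNReal.ofReal (f n x) ∂μ := by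
    intro μ _ n
    exact ofReal_integral_eq_lintegral_ofReal
      ((hf_cont n).integrable_of_hasCompactSupport (hf_supp n)) (Eventually.of_forall (hf0 n))
  have hfP : ∀ n, ∫⁻ x, ENNReal.ofReal (f n x) ∂P ≤ C := by
    intro n
    rw [← hint P n]
    refine le_of_tendsto (ENNReal.tendsto_ofReal (h (f n) (hf_cont n) (hf_supp n))) ?_
    filter_upwards [hC] with i hi
    have := hm i
    rw [hint (m i) n]
    exact (lintegral_mono (hf_le n)).trans hi
  have hlim : ∀ x, g x ≤ liminf (fun n => ENNReal.ofReal (f n x)) atTop := by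
    intro x
    refine le_of_forall_lt fun c hc => ?_
    obtain ⟨c', hc', hc'g⟩ := exists_between hc
    refine hc'.trans_le ?_
    have hc'top : c' ≠ ⊤ := (hc'g.trans_le le_top).ne
    refine le_liminf_of_le (by isBoundedDefault) ?_
    obtain ⟨r, hr, hball⟩ := Metric.mem_nhds_iff.1 (hg x c' hc'g)
    obtain ⟨N, hN⟩ := exists_nat_gt c'.toReal
    obtain ⟨N', hN'⟩ := exists_nat_gt (c'.toReal / r)
    obtain ⟨N'', hN''⟩ := K.exists_mem x
    filter_upwards [eventually_ge_atTop N, eventually_ge_atTop N', eventually_ge_atTop N'']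
      with n h1 h2 h3
    have hx : χ n x = 1 := hχ1 n (K.subset h3 hN'')
    simp only [f, hx, one_mul]
    rw [ENNReal.ofReal_toReal (hh_ne n x)]
    refine le_iInf fun w => ?_
    by_cases hw : w ∈ Metric.ball x r
    · refine le_trans (le_min (hball hw).le ?_) le_self_add
      rw [← ENNReal.ofReal_toReal hc'top, ← ENNReal.ofReal_natCast]
      apply ENNReal.ofReal_le_ofReal
      exact hN.le.trans (by exact_mod_cast h1)
    · refine le_trans ?_ le_add_self
      rw [edist_dist, ← ENNReal.ofReal_toReal hc'top, ← ENNReal.ofReal_natCast,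
        ← ENNReal.ofReal_mul (by positivity)]
      apply ENNReal.ofReal_le_ofReal
      have hd : r ≤ dist x w := by
        rw [Metric.mem_ball, not_lt, dist_comm] at hw
        exact hw
      have h2' : (N' : ℝ) ≤ n := by exact_mod_cast h2
      rw [div_lt_iff₀ hr] at hN'
      nlinarith
  calc ∫⁻ x, g x ∂P ≤ ∫⁻ x, liminf (fun n => ENNReal.ofReal (f n x)) atTop ∂P :=
        lintegral_mono hlim
    _ ≤ liminf (fun n => ∫⁻ x, ENNReal.ofReal (f n x) ∂P) atTop :=
        lintegral_liminf_le fun n => (hf_cont n).measurable.ennreal_ofReal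
    _ ≤ C := by
        refine (liminf_le_liminf (Eventually.of_forall hfP)).trans ?_
        simp

lemma IsKernel.lowerSemicontinuous_pot (hk : IsKernel κ) (μ : Measure X) :
    LowerSemicontinuous (pot κ μ) := by
  let := TopologicalSpace.metrizableSpaceMetric X
  rw [lowerSemicontinuous_iff_isClosed_preimage]
  intro c
  refine IsSeqClosed.isClosed fun u x hu hx => ?_
  have h1 : ∀ y, κ x y ≤ liminf (fun n => κ (u n) y) atTop := by
    intro y
    refine le_of_forall_lt fun a ha => ?_
    obtain ⟨b, hb, hb'⟩ := exists_between ha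
    refine hb.trans_le (le_liminf_of_le (by isBoundedDefault) ?_)
    have : Tendsto (fun n => (u n, y)) atTop (𝓝 (x, y)) := hx.prodMk_nhds tendsto_const_nhds
    filter_upwards [this.eventually (hk.lsc (x, y) b hb')] with n hn using hn.le
  calc pot κ μ x ≤ ∫⁻ y, liminf (fun n => κ (u n) y) atTop ∂μ := lintegral_mono h1
    _ ≤ liminf (fun n => ∫⁻ y, κ (u n) y ∂μ) atTop :=
        lintegral_liminf_le fun n => hk.measurable_uncurry.of_uncurry_left
    _ ≤ c := by
        refine (liminf_le_liminf (Eventually.of_forall hu)).trans ?_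
        simp

lemma exists_vagueConv {ι : Type*} (G : Ultrafilter ι) (m : ι → Measure X)
    (hm : ∀ i, IsLocallyFiniteMeasure (m i))
    (hK : ∀ K : Set X, IsCompact K → ∃ M : ℝ≥0, ∀ᶠ i in (G : Filter ι), m i K ≤ M) :
    ∃ P : Measure X, IsLocallyFiniteMeasure P ∧ VagueConv (G : Filter ι) m P := by
  have hint : ∀ i (f : CompactlySupportedContinuousMap X ℝ), Integrable f (m i) := fun i f =>
    f.continuous.integrable_of_hasCompactSupport f.hasCompactSupport
  have hlim : ∀ f : CompactlySupportedContinuousMap X ℝ,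
      ∃ a : ℝ, Tendsto (fun i => ∫ x, f x ∂(m i)) G (𝓝 a) := by
    intro f
    obtain ⟨M, hM⟩ := hK (tsupport f) f.hasCompactSupport
    obtain ⟨B, hB⟩ := f.continuous.bounded_above_of_compact_support f.hasCompactSupport
    have hbd : ∀ᶠ i in (G : Filter ι), ∫ x, f x ∂(m i) ∈ Metric.closedBall (0 : ℝ) (|B| * M) := by
      filter_upwards [hM] with i hi
      have hfin : m i (tsupport f) < ⊤ := hi.trans_lt ENNReal.coe_lt_top
      rw [mem_closedBall_zero_iff, ← setIntegral_eq_integral_of_forall_compl_eq_zero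
        (s := tsupport f) fun x hx => image_eq_zero_of_notMem_tsupport hx]
      refine (norm_setIntegral_le_of_norm_le_const hfin fun x _ => (hB x).trans (le_abs_self B)).trans ?_
      exact mul_le_mul_of_nonneg_left (ENNReal.toReal_le_coe_of_le_coe hi) (abs_nonneg B)
    obtain ⟨a, -, ha⟩ := (isCompact_closedBall (0 : ℝ) (|B| * M)).ultrafilter_le_nhds
      (G.map fun i => ∫ x, f x ∂(m i)) (le_principal_iff.2 hbd)
    exact ⟨a, ha⟩
  choose Λ hΛ using hlim
  let L : CompactlySupportedContinuousMap X ℝ →ₗ[ℝ] ℝ :=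
    { toFun := Λ
      map_add' := fun f g => by
        refine tendsto_nhds_unique (hΛ (f + g)) (((hΛ f).add (hΛ g)).congr fun i => ?_)
        exact (integral_add (hint i f) (hint i g)).symm
      map_smul' := fun c f => by
        refine tendsto_nhds_unique (hΛ (c • f)) (((hΛ f).const_mul c).congr fun i => ?_)
        exact (integral_const_mul c _).symm }
  let L' : CompactlySupportedContinuousMap X ℝ →ₚ[ℝ] ℝ :=
    PositiveLinearMap.mk₀ L fun f hf =>
      ge_of_tendsto (hΛ f) (Eventually.of_forall fun i => integral_nonneg fun x => hf x)
  refine ⟨RealRMK.rieszMeasure L', inferInstance, fun f hf hfc => ?_⟩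
  have := RealRMK.integral_rieszMeasure L' ⟨⟨f, hf⟩, hfc⟩
  have h2 := hΛ ⟨⟨f, hf⟩, hfc⟩
  change Tendsto _ _ (𝓝 (L' ⟨⟨f, hf⟩, hfc⟩)) at h2
  rw [← this] at h2
  exact h2

end Vague

section Projection

variable [SecondCountableTopology X] {κ : X → X → ℝ≥0∞} {μ ν σ τ P Q θ : Measure X}
  {A B : Set X}

lemma mem_EplusOn : ν ∈ EplusOn κ A ↔ ν ∈ Eplus κ ∧ ν Aᶜ = 0 := by
  refine ⟨fun h => ⟨h.1, ?_⟩, fun h => ⟨h.1, ?_, fun K _ => measure_mono_null inter_subset_left h.2⟩⟩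
  · have : Aᶜ = ⋃ n, Aᶜ ∩ compactCovering X n := by
      rw [← inter_iUnion, iUnion_compactCovering, inter_univ]
    rw [this]
    exact measure_iUnion_null fun n => h.2.2 _ (isCompact_compactCovering X n)
  · have : NullMeasurableSet Aᶜ ν := NullMeasurableSet.of_null h.2
    simpa using this.compl

/-- Strong convergence of a sequence of measures. -/
def StrongLim (κ : X → X → ℝ≥0∞) (m : ℕ → Measure X) (P : Measure X) : Prop :=
  Tendsto (fun i => dist2 κ (m i) P) atTop (𝓝 0)

/-- `P` is the orthogonal projection of `μ` onto the strong closure of `E⁺_A`. -/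
structure IsProj (κ : X → X → ℝ≥0∞) (A : Set X) (μ P : Measure X) : Prop where
  mem : P ∈ Eplus κ
  approx : ∃ m : ℕ → Measure X, (∀ n, m n ∈ EplusOn κ A) ∧ StrongLim κ m P
  le : ∀ ν ∈ EplusOn κ A, renergy κ μ ν ≤ renergy κ P ν
  self : renergy κ P P = renergy κ μ P

namespace Admissible

variable (hκ : Admissible κ)
include hκ

lemma add_memOn (hμ : μ ∈ EplusOn κ A) (hν : ν ∈ EplusOn κ A) : μ + ν ∈ EplusOn κ A := by
  rw [mem_EplusOn] at *
  exact ⟨hκ.add_mem hμ.1 hν.1, by simp [hμ.2, hν.2]⟩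

omit hκ in
lemma smul_memOn (c : ℝ≥0) (hμ : μ ∈ EplusOn κ A) : c • μ ∈ EplusOn κ A := by
  rw [mem_EplusOn] at *
  exact ⟨smul_mem c hμ.1, by simp [hμ.2]⟩

omit hκ in
lemma mono_memOn (hμ : μ ∈ EplusOn κ A) (h : A ⊆ B) : μ ∈ EplusOn κ B := by
  rw [mem_EplusOn] at *
  exact ⟨hμ.1, measure_mono_null (compl_subset_compl.2 h) hμ.2⟩

lemma tendsto_renergy {m : ℕ → Measure X} (hm : ∀ i, m i ∈ Eplus κ) (hP : P ∈ Eplus κ)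
    (h : StrongLim κ m P) (hσ : σ ∈ Eplus κ) :
    Tendsto (fun i => renergy κ σ (m i)) atTop (𝓝 (renergy κ σ P)) := by
  rw [tendsto_iff_dist_tendsto_zero]
  have h1 : Tendsto (fun i => Real.sqrt (dist2 κ (m i) P) * (renergy κ σ σ + 1)) atTop (𝓝 0) := by
    have := ((Real.continuous_sqrt.tendsto 0).comp h).mul_const (renergy κ σ σ + 1)
    simpa using this
  exact squeeze_zero (fun _ => dist_nonneg) (fun i => hκ.abs_sub_le (hm i) hP hσ) h1

lemma tendsto_self {m : ℕ → Measure X} (hm : ∀ i, m i ∈ Eplus κ) (hP : P ∈ Eplus κ)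
    (h : StrongLim κ m P) :
    Tendsto (fun i => renergy κ (m i) (m i)) atTop (𝓝 (renergy κ P P)) := by
  have h1 := hκ.tendsto_renergy hm hP h hP
  have h2 := (h.add (h1.const_mul 2)).sub_const (renergy κ P P)
  have e1 : 0 + 2 * renergy κ P P - renergy κ P P = renergy κ P P := by ring
  rw [e1] at h2
  refine h2.congr fun i => ?_
  simp only [dist2]
  rw [hκ.comm (hm i) hP]
  ring

/-- The cone `E⁺` is strongly complete. -/
theorem complete {m : ℕ → Measure X} (hm : ∀ i, m i ∈ Eplus κ)
    (hC : ∀ ε : ℝ, 0 < ε → ∃ N, ∀ i ≥ N, ∀ j ≥ N, dist2 κ (m i) (m j) < ε) :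
    ∃ P ∈ Eplus κ, StrongLim κ m P ∧
      ∀ F : Set X, IsClosed F → (∀ᶠ i in atTop, m i Fᶜ = 0) → P Fᶜ = 0 := by
  have hlf : ∀ i, IsLocallyFiniteMeasure (m i) := fun i => (hm i).1.2
  obtain ⟨N, hN⟩ := hC 1 one_pos
  obtain ⟨C, hC0⟩ : ∃ C : ℝ≥0, ∀ i ≥ N, renergy κ (m i) (m i) ≤ C := by
    refine ⟨Real.toNNReal (1 + 2 * (renergy κ (m N) (m N) + (renergy κ (m N) (m N) + 1))),
      fun i hi => le_trans ?_ (Real.le_coe_toNNReal _)⟩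
    have h1 := hN i hi N le_rfl
    have h2 := (le_abs_self _).trans (hκ.abs_sub_le (hm i) (hm N) (hm N))
    have h3 : Real.sqrt (dist2 κ (m i) (m N)) ≤ 1 := Real.sqrt_le_one.2 h1.le
    have h4 := renergy_nonneg (κ := κ) (m N) (m N)
    simp only [dist2] at h1
    rw [hκ.comm (hm i) (hm N)] at h1
    nlinarith
  have hCe : ∀ i ≥ N, energy κ (m i) (m i) ≤ C := fun i hi => by
    rw [← ENNReal.ofReal_toReal (hm i).2.ne, ← ENNReal.ofReal_coe_nnreal]
    exact ENNReal.ofReal_le_ofReal (hC0 i hi)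
  have hCm : ∀ σ ∈ Eplus κ, ∀ i ≥ N, energy κ (m i) σ ≤ C + energy κ σ σ := fun σ hσ i hi => by
    have h1 := (hκ.ener (m i) (hm i) σ hσ).1
    calc energy κ (m i) σ ≤ energy κ (m i) σ + energy κ (m i) σ := le_self_add
      _ = 2 * energy κ (m i) σ := (two_mul _).symm
      _ ≤ _ := h1.trans (by gcongr; exact hCe i hi)
  have hCj : ∀ i ≥ N, ∀ j ≥ N, energy κ (m i) (m j) ≤ (C + C : ℝ≥0) := fun i hi j hj => by
    push_cast
    exact (hCm _ (hm j) i hi).trans (by gcongr; exact hCe j hj)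
  let G : Ultrafilter ℕ := Ultrafilter.of atTop
  have hG : (G : Filter ℕ) ≤ atTop := Ultrafilter.of_le atTop
  have hNG : ∀ᶠ i in (G : Filter ℕ), N ≤ i := hG (eventually_ge_atTop N)
  obtain ⟨P, hPlf, hPG⟩ := exists_vagueConv G m hlf fun K hK => by
    obtain ⟨σ, hσ, hσ1⟩ := hκ.one_le K hK
    refine ⟨C + (energy κ σ σ).toNNReal, ?_⟩
    filter_upwards [hNG] with i hi
    rw [ENNReal.coe_add, ENNReal.coe_toNNReal hσ.2.ne]
    refine le_trans ?_ (hCm σ hσ i hi)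
    calc m i K = ∫⁻ x in K, 1 ∂(m i) := by simp
      _ ≤ ∫⁻ x in K, pot κ σ x ∂(m i) := setLIntegral_mono_ae'  hK.measurableSet
          (Eventually.of_forall fun x hx => hσ1 x hx)
      _ ≤ _ := setLIntegral_le_lintegral _ _
  have hPm : ∀ j ≥ N, energy κ P (m j) ≤ (C + C : ℝ≥0) := fun j hj =>
    lintegral_le_of_vagueConv hlf hPG (hκ.ker.lowerSemicontinuous_pot (m j))
      (hNG.mono fun i hi => hCj i hi j hj)
  have hPE : P ∈ Eplus κ := by
    refine ⟨isRadon_iff.2 hPlf, lt_of_le_of_lt ?_ (ENNReal.coe_lt_top (r := C + C))⟩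
    refine lintegral_le_of_vagueConv hlf hPG (hκ.ker.lowerSemicontinuous_pot P)
      (hNG.mono fun i hi => ?_)
    change energy κ (m i) P ≤ _
    rw [energy_comm hκ.ker]
    exact hPm i hi
  refine ⟨P, hPE, ?_, fun F hF h0 => ?_⟩
  · have hcauchy : StrongCauchy κ atTop m := by
      intro ε hε
      obtain ⟨M, hM⟩ := hC (ε ^ 2) (by positivity)
      refine ⟨Ici M, Ici_mem_atTop M, fun i hi j hj => ?_⟩
      rw [strDist, Real.sqrt_lt' hε]
      exact hM i hi j hj
    have := hκ.cons ℕ atTop m inferInstance hm hcauchy P ⟨G, hG, inferInstance, hPG⟩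
    have h2 := this.pow 2
    rw [zero_pow two_ne_zero] at h2
    exact h2.congr fun i => Real.sq_sqrt (hκ.dist2_nonneg (hm i) hPE)
  · have := lintegral_le_of_vagueConv hlf hPG (g := Fᶜ.indicator 1) (C := 0)
      (hF.isOpen_compl.lowerSemicontinuous_indicator zero_le_one) (hG (h0.mono fun i hi => by
        rw [lintegral_indicator_one hF.measurableSet.compl, hi]))
    rw [lintegral_indicator_one hF.measurableSet.compl] at this
    simpa using this

theorem exists_isProj (hμ : μ ∈ Eplus κ) (A : Set X) :
    ∃ P, IsProj κ A μ P ∧ ∀ F : Set X, IsClosed F → A ⊆ F → P Fᶜ = 0 := by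
  let S : Set ℝ := (fun ν => dist2 κ μ ν) '' EplusOn κ A
  have hSne : S.Nonempty := ⟨_, 0, mem_EplusOn.2 ⟨zero_mem_Eplus, by simp⟩, rfl⟩
  have hSbd : BddBelow S := ⟨0, by rintro _ ⟨ν, hν, rfl⟩; exact hκ.dist2_nonneg hμ hν.1⟩
  have hd : ∀ ν ∈ EplusOn κ A, sInf S ≤ dist2 κ μ ν := fun ν hν => csInf_le hSbd ⟨ν, hν, rfl⟩
  have hex : ∀ n : ℕ, ∃ ν ∈ EplusOn κ A, dist2 κ μ ν < sInf S + 1 / ((n : ℝ) + 1) := by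
    intro n
    obtain ⟨_, ⟨ν, hν, rfl⟩, h⟩ := exists_lt_of_csInf_lt hSne
      (lt_add_of_pos_right (sInf S) (Nat.one_div_pos_of_nat (α := ℝ) (n := n)))
    exact ⟨ν, hν, h⟩
  choose m hmA hmd using hex
  have hm : ∀ n, m n ∈ Eplus κ := fun n => (hmA n).1
  have half : ((1 / 2 : ℝ≥0) : ℝ) = 1 / 2 := by push_cast; rfl
  have hpar : ∀ i j, dist2 κ (m i) (m j) ≤ 2 * (1 / ((i : ℝ) + 1)) + 2 * (1 / ((j : ℝ) + 1)) := by
    intro i j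
    have h := hd _ (smul_memOn (1 / 2) (hκ.add_memOn (hmA i) (hmA j)))
    have hi := hmd i
    have hj := hmd j
    have hij := hκ.add_mem (hm i) (hm j)
    simp only [dist2, smul_left, smul_right] at h hi hj ⊢
    rw [hκ.add_right (hm i) (hm j) hμ, hκ.add_left (hm i) (hm j) hij,
      hκ.add_right (hm i) (hm j) (hm i), hκ.add_right (hm i) (hm j) (hm j),
      hκ.comm (hm j) (hm i), half] at h
    linarith
  obtain ⟨P, hP, hlim, hsupp⟩ := hκ.complete hm fun ε hε => by
    obtain ⟨N, hN⟩ := exists_nat_one_div_lt (show 0 < ε / 4 by positivity)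
    refine ⟨N, fun i hi j hj => (hpar i j).trans_lt ?_⟩
    have h1 := Nat.one_div_le_one_div (α := ℝ) hi
    have h2 := Nat.one_div_le_one_div (α := ℝ) hj
    linarith
  have hlimE := fun {σ} (hσ : σ ∈ Eplus κ) => hκ.tendsto_renergy hm hP hlim hσ
  have hlimS := hκ.tendsto_self hm hP hlim
  have hdP : dist2 κ μ P ≤ sInf S := by
    have h1 : Tendsto (fun n => dist2 κ μ (m n)) atTop (𝓝 (dist2 κ μ P)) :=
      (tendsto_const_nhds.sub ((hlimE hμ).const_mul 2)).add hlimS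
    have h2 : Tendsto (fun n : ℕ => sInf S + 1 / ((n : ℝ) + 1)) atTop (𝓝 (sInf S + 0)) :=
      tendsto_const_nhds.add tendsto_one_div_add_atTop_nhds_zero_nat
    rw [add_zero] at h2
    exact le_of_tendsto_of_tendsto' h1 h2 fun n => (hmd n).le
  refine ⟨P, ⟨hP, ⟨m, hmA, hlim⟩, fun ν hν => ?_, ?_⟩, fun F hF hAF => hsupp F hF ?_⟩
  · have hpert : ∀ t : ℝ≥0, 0 ≤ 2 * (renergy κ P ν - renergy κ μ ν) + t * renergy κ ν ν ∨ t = 0 := by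
      intro t
      rcases eq_or_ne t 0 with ht | ht
      · exact Or.inr ht
      left
      have ht' : (0 : ℝ) < t := by positivity
      have hk : ∀ n, sInf S ≤ dist2 κ μ (m n) + 2 * t * (renergy κ ν (m n) - renergy κ μ ν)
          + t ^ 2 * renergy κ ν ν := by
        intro n
        have htν := smul_mem t hν.1
        have h := hd _ (hκ.add_memOn (hmA n) (smul_memOn t hν))
        simp only [dist2] at h ⊢
        rw [hκ.add_right (hm n) htν hμ, hκ.add_left (hm n) htν (hκ.add_mem (hm n) htν),
          hκ.add_right (hm n) htν (hm n), hκ.add_right (hm n) htν htν] at h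
        simp only [smul_left, smul_right] at h
        rw [hκ.comm (hm n) hν.1] at h
        linarith
      have hk' : sInf S ≤ dist2 κ μ P + 2 * t * (renergy κ ν P - renergy κ μ ν)
          + t ^ 2 * renergy κ ν ν := by
        have h1 : Tendsto (fun n => dist2 κ μ (m n)) atTop (𝓝 (dist2 κ μ P)) :=
          (tendsto_const_nhds.sub ((hlimE hμ).const_mul 2)).add hlimS
        exact ge_of_tendsto' ((h1.add (((hlimE hν.1).sub_const _).const_mul _)).add_const _) hk
      rw [hκ.comm hν.1 hP] at hk'
      have : 0 ≤ (t : ℝ) * (2 * (renergy κ P ν - renergy κ μ ν) + t * renergy κ ν ν) := by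
        nlinarith
      exact nonneg_of_mul_nonneg_right this ht'
    by_contra! hcon
    have hν0 := renergy_nonneg (κ := κ) ν ν
    have hs : 0 < (renergy κ μ ν - renergy κ P ν) / (renergy κ ν ν + 1) :=
      div_pos (by linarith) (by linarith)
    rcases hpert ⟨_, hs.le⟩ with h | h
    · have e1 : (renergy κ μ ν - renergy κ P ν) / (renergy κ ν ν + 1) * renergy κ ν ν
          ≤ renergy κ μ ν - renergy κ P ν := by
        rw [div_mul_eq_mul_div, div_le_iff₀ (by linarith)]
        nlinarith
      change 0 ≤ _ + (renergy κ μ ν - renergy κ P ν) / (renergy κ ν ν + 1) * renergy κ ν ν at h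
      linarith
    · exact hs.ne' (congrArg NNReal.toReal h)
  · have hpert : ∀ s : ℝ≥0, renergy κ P P - 2 * renergy κ μ P
        ≤ s ^ 2 * renergy κ P P - 2 * s * renergy κ μ P := by
      intro s
      have hk : ∀ n, sInf S ≤ renergy κ μ μ + (s ^ 2 * renergy κ (m n) (m n)
          - 2 * s * renergy κ μ (m n)) := by
        intro n
        have h := hd _ (smul_memOn s (hmA n))
        simp only [dist2, smul_left, smul_right] at h ⊢
        linarith
      have hk' : sInf S ≤ renergy κ μ μ + (s ^ 2 * renergy κ P P - 2 * s * renergy κ μ P) := by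
        exact ge_of_tendsto' (((hlimS.const_mul _).sub ((hlimE hμ).const_mul _)).const_add _) hk
      simp only [dist2] at hdP
      linarith
    have a0 := renergy_nonneg (κ := κ) P P
    have b0 := renergy_nonneg (κ := κ) μ P
    generalize renergy κ P P = a at *
    generalize renergy κ μ P = b at *
    have h0 := hpert 0
    rcases a0.eq_or_lt with rfl | ha
    · have := hpert 2
      push_cast at h0 this
      linarith
    · have := hpert ⟨b / a, div_nonneg b0 a0⟩
      change a - 2 * b ≤ (b / a) ^ 2 * a - 2 * (b / a) * b at this
      have e1 : (b / a) ^ 2 * a - 2 * (b / a) * b = - (b ^ 2 / a) := by field_simp; ring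
      rw [e1] at this
      have e2 : (a - b) ^ 2 / a ≤ 0 := by
        have : (a - b) ^ 2 / a = a - 2 * b + b ^ 2 / a := by field_simp; ring
        linarith
      have e3 : (a - b) ^ 2 ≤ 0 := by
        rw [div_le_iff₀ ha] at e2
        linarith
      linarith [pow_eq_zero_iff two_ne_zero |>.1 (le_antisymm e3 (sq_nonneg _))]
  · exact Eventually.of_forall fun n =>
      measure_mono_null (compl_subset_compl.2 hAF) (mem_EplusOn.1 (hmA n)).2

end Admissible

end Projection

section Sweeping

variable [SecondCountableTopology X] {κ : X → X → ℝ≥0∞} {μ ν σ τ P Q R θ : Measure X}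
  {A B D : Set X}

namespace Admissible

variable (hκ : Admissible κ)
include hκ

lemma renergy_le_of_ae_le (hP : P ∈ Eplus κ) (hθ : θ ∈ Eplus κ) (hτ : τ ∈ Eplus κ)
    (h : ∀ᵐ x ∂τ, pot κ P x ≤ pot κ θ x) : renergy κ P τ ≤ renergy κ θ τ := by
  rw [hκ.comm hP hτ, hκ.comm hθ hτ]
  exact ENNReal.toReal_mono (hκ.energy_lt_top hτ hθ).ne (lintegral_mono_ae h)

lemma ae_pot_le (hP : P ∈ Eplus κ) (hθ : θ ∈ Eplus κ) (hτ : τ ∈ Eplus κ)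
    (h : ∀ σ ∈ Eplus κ, σ ≤ τ → renergy κ P σ ≤ renergy κ θ σ) :
    ∀ᵐ x ∂τ, pot κ P x ≤ pot κ θ x := by
  have := hP.1.2
  have := hτ.1.2
  refine ae_le_of_forall_setLIntegral_le_of_sigmaFinite (hκ.ker.measurable_pot P) fun s _ _ => ?_
  have hσ : τ.restrict s ∈ Eplus κ := mono_mem hτ Measure.restrict_le_self
  have h1 := h _ hσ Measure.restrict_le_self
  rw [hκ.comm hP hσ, hκ.comm hθ hσ] at h1
  exact (ENNReal.toReal_le_toReal (hκ.energy_lt_top hσ hP).ne (hκ.energy_lt_top hσ hθ).ne).1 h1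

omit hκ in
lemma le_memOn (hν : ν ∈ EplusOn κ A) (h : σ ≤ ν) : σ ∈ EplusOn κ A := by
  rw [mem_EplusOn] at *
  exact ⟨mono_mem hν.1 h, le_antisymm ((h _).trans hν.2.le) zero_le⟩

omit hκ in
lemma restrict_memOn (hν : ν ∈ Eplus κ) (hD : MeasurableSet D) : ν.restrict D ∈ EplusOn κ D :=
  mem_EplusOn.2 ⟨mono_mem hν Measure.restrict_le_self, by
    rw [Measure.restrict_apply hD.compl]; simp⟩

omit hκ in
lemma renergy_restrict_le (hν : ν ∈ Eplus κ) (D : Set X) :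
    renergy κ (ν.restrict D) (ν.restrict D) ≤ renergy κ ν ν :=
  ENNReal.toReal_mono hν.2.ne (lintegral_mono' Measure.restrict_le_self
    fun _ => lintegral_mono' Measure.restrict_le_self le_rfl)

lemma ae_pot_leOn (hP : P ∈ Eplus κ) (hθ : θ ∈ Eplus κ)
    (h : ∀ ν ∈ EplusOn κ A, renergy κ P ν ≤ renergy κ θ ν) (hτ : τ ∈ EplusOn κ A) :
    ∀ᵐ x ∂τ, pot κ P x ≤ pot κ θ x :=
  hκ.ae_pot_le hP hθ hτ.1 fun σ _ hσ' => h σ (le_memOn hτ hσ')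

lemma exists_compact_approx (hμ : μ ∈ Eplus κ) (hν : ν ∈ EplusOn κ A) {ε : ℝ} (hε : 0 < ε) :
    ∃ C ⊆ A, IsCompact C ∧ renergy κ μ ν ≤ renergy κ μ (ν.restrict C) + ε := by
  have hνE := hν.1
  have hlfν := hν.1.1.2
  have hlfμ := hμ.1.2
  have hmeas := hκ.ker.measurable_pot μ
  let ρ : Measure X := ν.withDensity (pot κ μ)
  have hρ : IsFiniteMeasure ρ :=
    isFiniteMeasure_withDensity (hκ.energy_lt_top hν.1 hμ).ne
  have hρ' : ρ.InnerRegular := (isRadon_iff.2 inferInstance).1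
  obtain ⟨A', hA'A, hA'm, hA'e⟩ := hν.2.1.exists_measurable_subset_ae_eq
  have hA'0 : ν A'ᶜ = 0 := by
    rw [measure_congr hA'e.compl]
    exact (mem_EplusOn.1 hν).2
  have hρ0 : ρ A'ᶜ = 0 := withDensity_absolutelyContinuous _ _ hA'0
  obtain ⟨C, hCA, hC, hlt⟩ := hA'm.exists_isCompact_lt_add (measure_ne_top ρ A')
    (ε := ENNReal.ofReal ε) (by simpa using hε)
  refine ⟨C, hCA.trans hA'A, hC, ?_⟩
  have hσ : ν.restrict C ∈ Eplus κ := mono_mem hνE Measure.restrict_le_self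
  have e1 : energy κ ν μ = ρ A' := by
    rw [← add_zero (ρ A'), ← hρ0, measure_add_measure_compl hA'm,
      withDensity_apply _ MeasurableSet.univ, Measure.restrict_univ]
    rfl
  have e2 : energy κ (ν.restrict C) μ = ρ C := by
    rw [withDensity_apply _ hC.measurableSet]
    rfl
  rw [hκ.comm hμ hνE, hκ.comm hμ hσ, renergy, renergy, e1, e2, ← ENNReal.toReal_ofReal hε.le,
    ← ENNReal.toReal_add (measure_ne_top _ _) ENNReal.ofReal_ne_top]
  exact ENNReal.toReal_mono (ENNReal.add_lt_top.2 ⟨measure_lt_top _ _, ENNReal.ofReal_lt_top⟩).ne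
    hlt.le


lemma pot_le_of_mem (h : IsProj κ A μ Q) (hQ : Q ∈ EplusOn κ A) (hμ : μ ∈ Eplus κ)
    (hθ : θ ∈ Eplus κ) (hle : ∀ ν ∈ EplusOn κ A, renergy κ μ ν ≤ renergy κ θ ν) (x : X) :
    pot κ Q x ≤ pot κ θ x := by
  have := h.mem.1.2
  refine hκ.dom Q h.mem θ hθ ?_ x
  have h1 : ∀ᵐ x ∂Q, pot κ μ x ≤ pot κ Q x := hκ.ae_pot_leOn hμ h.mem h.le hQ
  have h2 : ∀ᵐ x ∂Q, pot κ μ x ≤ pot κ θ x := hκ.ae_pot_leOn hμ hθ hle hQ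
  have h3 : pot κ μ =ᵐ[Q] pot κ Q := by
    refine ae_eq_of_ae_le_of_lintegral_le h1 (hκ.energy_lt_top h.mem hμ).ne
      (hκ.ker.measurable_pot Q).aemeasurable ?_
    have := h.self
    rw [hκ.comm hμ h.mem] at this
    exact ((ENNReal.toReal_eq_toReal_iff' h.mem.2.ne (hκ.energy_lt_top h.mem hμ).ne).1 this).le
  filter_upwards [h2, h3] with x hx2 hx3
  rw [← hx3]
  exact hx2

lemma pot_le_of_strongLim {m : ℕ → Measure X} (hm : ∀ n, m n ∈ Eplus κ) (hP : P ∈ Eplus κ)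
    (h : StrongLim κ m P) (hθ : θ ∈ Eplus κ) (hle : ∀ n x, pot κ (m n) x ≤ pot κ θ x) (x : X) :
    pot κ P x ≤ pot κ θ x := by
  refine hκ.dom P hP θ hθ (hκ.ae_pot_le hP hθ hP fun σ hσ _ => ?_) x
  have h1 := hκ.tendsto_renergy hm hP h hσ
  rw [hκ.comm hP hσ, hκ.comm hθ hσ]
  refine le_of_tendsto' h1 fun n => ?_
  rw [hκ.comm hσ (hm n), hκ.comm hσ hθ]
  exact hκ.renergy_le_of_ae_le (hm n) hθ hσ (Eventually.of_forall (hle n))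

lemma exists_compact_isProj (hμ : μ ∈ Eplus κ) (hP : IsProj κ A μ P) :
    ∃ (C : ℕ → Set X) (Q : ℕ → Measure X), (∀ n, C n ⊆ A) ∧ (∀ n, IsCompact (C n)) ∧
      (∀ n, IsProj κ (C n) μ (Q n)) ∧ (∀ n, Q n ∈ EplusOn κ (C n)) ∧ StrongLim κ Q P := by
  obtain ⟨m, hmA, hlim⟩ := hP.approx
  have hm : ∀ n, m n ∈ Eplus κ := fun n => (hmA n).1
  choose C hCA hC hCε using fun n =>
    hκ.exists_compact_approx hμ (hmA n) (Nat.one_div_pos_of_nat (α := ℝ) (n := n))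
  choose Q hQ hQsupp using fun n => hκ.exists_isProj hμ (C n)
  have hQC : ∀ n, Q n ∈ EplusOn κ (C n) := fun n =>
    mem_EplusOn.2 ⟨(hQ n).mem, hQsupp n _ (hC n).isClosed Subset.rfl⟩
  refine ⟨C, Q, hCA, hC, hQ, hQC, ?_⟩
  have h1 := hκ.tendsto_self hm hP.mem hlim
  have h2 := hκ.tendsto_renergy hm hP.mem hlim hμ
  have h3 : Tendsto (fun n : ℕ => (renergy κ (m n) (m n) - 2 * renergy κ μ (m n) +
      2 * (1 / ((n : ℝ) + 1))) + renergy κ P P) atTop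
      (𝓝 ((renergy κ P P - 2 * renergy κ μ P + 2 * 0) + renergy κ P P)) :=
    ((h1.sub (h2.const_mul 2)).add (tendsto_one_div_add_atTop_nhds_zero_nat.const_mul 2)).add_const _
  have e : (renergy κ P P - 2 * renergy κ μ P + 2 * 0) + renergy κ P P = 0 := by
    rw [hP.self]; ring
  rw [e] at h3
  refine squeeze_zero (fun n => hκ.dist2_nonneg (hQ n).mem hP.mem) (fun n => ?_) h3
  have hν : (m n).restrict (C n) ∈ Eplus κ := mono_mem (hm n) Measure.restrict_le_self
  have hνC : (m n).restrict (C n) ∈ EplusOn κ (C n) :=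
    restrict_memOn (hm n) (hC n).measurableSet
  have a1 := hκ.dist2_nonneg hν (hQ n).mem
  have a2 := (hQ n).le _ hνC
  have a3 := (hQ n).self
  have a4 := hP.le _ (mono_memOn (hQC n) (hCA n))
  have a5 := hCε n
  have a6 : renergy κ ((m n).restrict (C n)) ((m n).restrict (C n)) ≤ renergy κ (m n) (m n) :=
    renergy_restrict_le (hm n) (C n)
  simp only [dist2] at a1 ⊢
  rw [hκ.comm hν (hQ n).mem] at a1
  rw [hκ.comm (hQ n).mem hP.mem]
  linarith

theorem pot_le (hP : IsProj κ A μ P) (hμ : μ ∈ Eplus κ) (hθ : θ ∈ Eplus κ)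
    (hle : ∀ ν ∈ EplusOn κ A, renergy κ μ ν ≤ renergy κ θ ν) (x : X) :
    pot κ P x ≤ pot κ θ x := by
  obtain ⟨C, Q, hCA, hC, hQ, hQC, hlim⟩ := hκ.exists_compact_isProj hμ hP
  exact hκ.pot_le_of_strongLim (fun n => (hQ n).mem) hP.mem hlim hθ (fun n =>
    hκ.pot_le_of_mem (hQ n) (hQC n) hμ hθ fun ν hν => hle ν (mono_memOn hν (hCA n))) x

lemma pot_le_self (hP : IsProj κ A μ P) (hμ : μ ∈ Eplus κ) (x : X) : pot κ P x ≤ pot κ μ x :=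
  hκ.pot_le hP hμ hμ (fun _ _ => le_rfl) x

lemma renergy_eq_of_memOn (hP : IsProj κ A μ P) (hμ : μ ∈ Eplus κ) (hν : ν ∈ EplusOn κ A) :
    renergy κ P ν = renergy κ μ ν :=
  le_antisymm (hκ.renergy_le_of_ae_le hP.mem hμ hν.1 (Eventually.of_forall (hκ.pot_le_self hP hμ)))
    (hP.le ν hν)

lemma renergy_eq_of_isProj (hP : IsProj κ A μ P) (hμ : μ ∈ Eplus κ) (hR : IsProj κ B ν R)
    (h : B ⊆ A) : renergy κ P R = renergy κ μ R := by
  obtain ⟨m, hmA, hlim⟩ := hR.approx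
  have hm : ∀ n, m n ∈ Eplus κ := fun n => (hmA n).1
  have h1 := hκ.tendsto_renergy hm hR.mem hlim hP.mem
  have h2 := hκ.tendsto_renergy hm hR.mem hlim hμ
  refine tendsto_nhds_unique h1 (h2.congr fun n => ?_)
  rw [hκ.renergy_eq_of_memOn hP hμ (mono_memOn (hmA n) h)]

/-- Symmetry of balayage. -/
theorem renergy_isProj_comm (hP : IsProj κ A μ P) (hμ : μ ∈ Eplus κ) (hR : IsProj κ A ν R)
    (hν : ν ∈ Eplus κ) : renergy κ P ν = renergy κ R μ := by
  rw [hκ.comm hR.mem hμ, ← hκ.renergy_eq_of_isProj hP hμ hR Subset.rfl, hκ.comm hP.mem hR.mem,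
    hκ.renergy_eq_of_isProj hR hν hP Subset.rfl, hκ.comm hν hP.mem]

lemma eq_of_pot_eq (hP : P ∈ Eplus κ) (hR : R ∈ Eplus κ) (h : ∀ x, pot κ P x = pot κ R x) :
    P = R := by
  refine hκ.eq_of_dist2_eq_zero hP hR ?_
  have h' : pot κ P = pot κ R := funext h
  have e1 : renergy κ P R = renergy κ P P := by simp only [renergy, energy, h']
  have e2 : renergy κ R R = renergy κ R P := by simp only [renergy, energy, h']
  rw [dist2, e2, hκ.comm hR hP, e1]
  ring

omit hκ in
lemma innerCap_eq_zero_iff {E : Set X} : innerCap κ E = 0 ↔ ∀ ν ∈ EplusOn κ E, ν = 0 := by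
  constructor
  · intro h ν hν
    rw [innerCap, ENNReal.inv_eq_zero, iInf₂_eq_top] at h
    have hlf := hν.1.1.2
    have hK : ∀ K : Set X, IsCompact K → ν K = 0 := by
      intro K hK
      by_contra h0
      have hfin : ν K ≠ ⊤ := hK.measure_ne_top
      let c : ℝ≥0 := ((ν K).toNNReal)⁻¹
      have hc : (c : ℝ≥0∞) * ν K = 1 := by
        rw [ENNReal.coe_inv (by simp [ENNReal.toNNReal_eq_zero_iff, h0, hfin]),
          ENNReal.coe_toNNReal hfin]
        exact ENNReal.inv_mul_cancel h0 hfin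
      have hσ : c • (ν.restrict K) ∈ EplusOn κ E :=
        smul_memOn c (le_memOn hν Measure.restrict_le_self)
      have := h _ ⟨hσ, by
        rw [Measure.smul_apply, Measure.restrict_apply_univ]; exact hc⟩
      exact hσ.1.2.ne this
    have : ν univ = 0 := by
      rw [← iUnion_compactCovering]
      exact measure_iUnion_null fun n => hK _ (isCompact_compactCovering X n)
    exact Measure.measure_univ_eq_zero.1 this
  · intro h
    rw [innerCap, ENNReal.inv_eq_zero, iInf₂_eq_top]
    rintro ν ⟨hν, h1⟩
    rw [h ν hν] at h1
    simp at h1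

lemma neOn_iff (hμ : μ ∈ Eplus κ) (hθ : θ ∈ Eplus κ) :
    NEOn κ A (fun x => pot κ μ x ≤ pot κ θ x) ↔
      ∀ ν ∈ EplusOn κ A, renergy κ μ ν ≤ renergy κ θ ν := by
  have := hμ.1.2
  have := hθ.1.2
  rw [NEOn, innerCap_eq_zero_iff]
  constructor
  · intro h ν hν
    refine hκ.renergy_le_of_ae_le hμ hθ hν.1 ?_
    have hN : MeasurableSet {x | ¬ pot κ μ x ≤ pot κ θ x} :=
      (measurableSet_le (hκ.ker.measurable_pot μ) (hκ.ker.measurable_pot θ)).compl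
    have hσ : ν.restrict {x | ¬ pot κ μ x ≤ pot κ θ x} ∈
        EplusOn κ {x | x ∈ A ∧ ¬ pot κ μ x ≤ pot κ θ x} := by
      refine mem_EplusOn.2 ⟨mono_mem hν.1 Measure.restrict_le_self, ?_⟩
      have hA := (mem_EplusOn.1 (le_memOn hν (Measure.restrict_le_self
        (s := {x | ¬ pot κ μ x ≤ pot κ θ x})))).2
      refine measure_mono_null (t := Aᶜ ∪ {x | ¬ pot κ μ x ≤ pot κ θ x}ᶜ) (fun x hx => ?_)
        (measure_union_null hA ?_)
      · simp only [mem_compl_iff, mem_ofPred_eq, not_and, mem_union] at hx ⊢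
        tauto
      · rw [Measure.restrict_apply hN.compl]
        simp
    have := h _ hσ
    rw [Measure.restrict_eq_zero] at this
    exact this
  · intro h ν hν
    have h1 := hκ.ae_pot_leOn hμ hθ h (mono_memOn hν fun x hx => hx.1)
    have h2 := (mem_EplusOn.1 hν).2
    have : ν univ = 0 := by
      refine measure_mono_null (fun x _ => ?_) (measure_union_null h1 h2)
      by_cases hx : pot κ μ x ≤ pot κ θ x
      · exact Or.inr fun hx' => hx'.2 hx
      · exact Or.inl hx
    exact Measure.measure_univ_eq_zero.1 this

theorem isInnerBal_iff (hμ : μ ∈ Eplus κ) : IsInnerBal κ A μ P ↔ IsProj κ A μ P := by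
  have key : ∀ {P}, IsProj κ A μ P → IsInnerBal κ A μ P := fun {P} h =>
    ⟨⟨h.mem, (hκ.neOn_iff hμ h.mem).2 h.le⟩, fun ν hν x =>
      hκ.pot_le h hμ hν.1 ((hκ.neOn_iff hμ hν.1).1 hν.2) x⟩
  refine ⟨fun h => ?_, key⟩
  obtain ⟨R, hR, -⟩ := hκ.exists_isProj hμ A
  have hR' := key hR
  rwa [hκ.eq_of_pot_eq h.1.1 hR.mem fun x => le_antisymm (h.2 R hR'.1 x) (hR'.2 P h.1 x)]

end Admissible

end Sweeping

section Capacitability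

variable {Y : Type*} [TopologicalSpace Y]

/-- A strongly subadditive set function on open sets, continuous along increasing sequences. -/
structure OpenCapacity (Φ : Set Y → ℝ) : Prop where
  nonneg : ∀ D, 0 ≤ Φ D
  mono : ∀ D G, IsOpen D → IsOpen G → D ⊆ G → Φ D ≤ Φ G
  union_add_inter : ∀ D G, IsOpen D → IsOpen G → Φ (D ∪ G) + Φ (D ∩ G) ≤ Φ D + Φ G
  iUnion_le : ∀ (D : ℕ → Set Y) (c : ℝ), Monotone D → (∀ n, IsOpen (D n)) →
    (∀ n, Φ (D n) ≤ c) → Φ (⋃ n, D n) ≤ c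

/-- The outer set function associated with a set function on open sets. -/
noncomputable def outerValue (Φ : Set Y → ℝ) (E : Set Y) : ℝ :=
  sInf (Φ '' {D | IsOpen D ∧ E ⊆ D})

namespace OpenCapacity

variable {Φ : Set Y → ℝ} (hΦ : OpenCapacity Φ)
include hΦ

lemma outerValue_le {E D : Set Y} (hD : IsOpen D) (h : E ⊆ D) : outerValue Φ E ≤ Φ D :=
  csInf_le ⟨0, by rintro _ ⟨D, -, rfl⟩; exact hΦ.nonneg D⟩ ⟨D, ⟨hD, h⟩, rfl⟩

omit hΦ in
lemma exists_lt {E : Set Y} {c : ℝ} (h : outerValue Φ E < c) :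
    ∃ D, IsOpen D ∧ E ⊆ D ∧ Φ D < c := by
  obtain ⟨_, ⟨D, hD, rfl⟩, hlt⟩ :=
    exists_lt_of_csInf_lt (s := Φ '' {D | IsOpen D ∧ E ⊆ D})
      ⟨_, univ, ⟨isOpen_univ, subset_univ E⟩, rfl⟩ h
  exact ⟨D, hD.1, hD.2, hlt⟩

lemma outerValue_iUnion_le {E : ℕ → Set Y} (hE : Monotone E) {c : ℝ}
    (hc : ∀ n, outerValue Φ (E n) ≤ c) : outerValue Φ (⋃ n, E n) ≤ c := by
  refine le_of_forall_pos_le_add fun ε hε => ?_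
  have hpos : ∀ n : ℕ, 0 < ε * (1 / 2) ^ (n + 1) := fun n => by positivity
  choose D hD hED hlt using fun n =>
    exists_lt (lt_add_of_pos_right (outerValue Φ (E n)) (hpos n))
  have hG : ∀ n, IsOpen (accumulate D n) := fun n => by
    rw [accumulate_def]
    exact isOpen_biUnion fun i _ => hD i
  have hEG : ∀ n, E n ⊆ accumulate D n := fun n => (hED n).trans (subset_accumulate)
  have key : ∀ n, Φ (accumulate D n) ≤ outerValue Φ (E n) + ε * (1 - (1 / 2) ^ (n + 1)) := by
    intro n
    induction n with
    | zero =>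
      have : accumulate D 0 = D 0 := by simp [accumulate]
      rw [this]
      have := (hlt 0).le
      norm_num at this ⊢
      linarith
    | succ n ih =>
      rw [accumulate_succ]
      have h1 := hΦ.union_add_inter _ _ (hG n) (hD (n + 1))
      have h2 := hΦ.outerValue_le ((hG n).inter (hD (n + 1)))
        (subset_inter (hEG n) ((hE n.le_succ).trans (hED (n + 1))))
      have h3 := (hlt (n + 1)).le
      have e : (1 / 2 : ℝ) ^ (n + 1 + 1) = (1 / 2) ^ (n + 1) / 2 := by rw [pow_succ]; ring
      rw [e] at h3 ⊢
      linarith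
  refine (hΦ.outerValue_le (isOpen_iUnion hG) (iUnion_mono hEG)).trans ?_
  refine hΦ.iUnion_le _ _ monotone_accumulate hG fun n => (key n).trans ?_
  have : 0 ≤ ε * (1 / 2) ^ (n + 1) := (hpos n).le
  linarith [hc n]

lemma exists_compact_of_lt {f : (ℕ → ℕ) → Y} (hf : Continuous f) {a : ℝ}
    (ha : a < outerValue Φ (range f)) :
    ∃ K ⊆ range f, IsCompact K ∧ ∀ D, IsOpen D → K ⊆ D → a ≤ Φ D := by
  have step : ∀ (k : ℕ) (S : {S : Set (ℕ → ℕ) // a < outerValue Φ (f '' S)}),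
      ∃ m : ℕ, a < outerValue Φ (f '' (S.1 ∩ {x | x k ≤ m})) := by
    intro k S
    by_contra! hcon
    have h1 := hΦ.outerValue_iUnion_le (E := fun m => f '' (S.1 ∩ {x | x k ≤ m}))
      (fun m m' hm => image_mono (inter_subset_inter_right _ fun x hx => le_trans hx hm)) hcon
    rw [← image_iUnion, ← inter_iUnion] at h1
    have : ⋃ m, {x : ℕ → ℕ | x k ≤ m} = univ := eq_univ_of_forall fun x =>
      mem_iUnion.2 ⟨x k, by simp⟩
    rw [this, inter_univ] at h1
    exact absurd S.2 (not_lt.2 h1)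
  choose m hm using step
  let S : ℕ → {S : Set (ℕ → ℕ) // a < outerValue Φ (f '' S)} := fun k =>
    Nat.rec ⟨univ, by rwa [image_univ]⟩ (fun k S => ⟨_, hm k S⟩) k
  let n : ℕ → ℕ := fun k => m k (S k)
  have hS : ∀ k, (S k).1 = {x | ∀ i < k, x i ≤ n i} := by
    intro k
    induction k with
    | zero => simp [S]
    | succ k ih =>
      have : (S (k + 1)).1 = (S k).1 ∩ {x | x k ≤ n k} := rfl
      rw [this, ih]
      ext x
      simp only [mem_inter_iff, mem_ofPred_eq, Nat.lt_succ_iff_lt_or_eq]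
      constructor
      · rintro ⟨h1, h2⟩ i (hi | rfl)
        · exact h1 i hi
        · exact h2
      · exact fun h => ⟨fun i hi => h i (Or.inl hi), h k (Or.inr rfl)⟩
  let T : Set (ℕ → ℕ) := Set.pi univ fun i => Iic (n i)
  have hT : IsCompact T := isCompact_univ_pi fun i => (finite_Iic (n i)).isCompact
  refine ⟨f '' T, image_subset_range f T, hT.image hf, fun D hD hTD => ?_⟩
  let := PiNat.metricSpaceNatNat
  obtain ⟨δ, hδ, hδD⟩ := hT.exists_thickening_subset_open (hD.preimage hf) (image_subset_iff.1 hTD)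
  obtain ⟨k, hk⟩ := exists_pow_lt_of_lt_one hδ (show (1 / 2 : ℝ) < 1 by norm_num)
  refine (S k).2.le.trans (hΦ.outerValue_le hD ?_)
  rw [image_subset_iff, hS]
  intro x hx
  refine hδD (Metric.mem_thickening_iff.2 ⟨fun i => min (x i) (n i), fun i _ => mem_Iic.2 (min_le_right _ _),
    lt_of_le_of_lt ?_ hk⟩)
  rw [← PiNat.mem_cylinder_iff_dist_le, PiNat.mem_cylinder_iff]
  exact fun i hi => (min_eq_left (hx i hi)).symm

/-- Choquet's capacitability theorem for Borel subsets of a compact set. -/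
theorem exists_compact_of_measurableSet [T2Space Y] [SecondCountableTopology Y]
    [MeasurableSpace Y] [BorelSpace Y] {E K₀ : Set Y} (hE : MeasurableSet E) (hK₀ : IsCompact K₀)
    (hEK : E ⊆ K₀) {a : ℝ} (ha : a < outerValue Φ E) :
    ∃ K ⊆ E, IsCompact K ∧ ∀ D, IsOpen D → K ⊆ D → a ≤ Φ D := by
  have := isCompact_iff_compactSpace.1 hK₀
  let := TopologicalSpace.metrizableSpaceMetric K₀
  have h1 : AnalyticSet ((↑) ⁻¹' E : Set K₀) := (measurable_subtype_coe hE).analyticSet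
  have h2 := h1.image_of_continuous continuous_subtype_val
  rw [Subtype.image_preimage_coe, inter_eq_right.2 hEK, AnalyticSet] at h2
  rcases h2 with rfl | ⟨f, hf, rfl⟩
  · exact ⟨∅, Subset.rfl, isCompact_empty, fun D hD h => ha.le.trans (hΦ.outerValue_le hD h)⟩
  · exact hΦ.exists_compact_of_lt hf ha

end OpenCapacity

end Capacitability

section BorelNull

variable [SecondCountableTopology X] {κ : X → X → ℝ≥0∞} {μ ν σ τ P Q R U I θ : Measure X}
  {A B D E K : Set X}

namespace Admissible

variable (hκ : Admissible κ)
include hκ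

lemma isProj_unique (hP : IsProj κ A μ P) (hR : IsProj κ A μ R) (hμ : μ ∈ Eplus κ) : P = R :=
  hκ.eq_of_pot_eq hP.mem hR.mem fun x =>
    le_antisymm (hκ.pot_le hP hμ hR.mem hR.le x) (hκ.pot_le hR hμ hP.mem hP.le x)

lemma isProj_null (hP : IsProj κ A μ P) (hμ : μ ∈ Eplus κ) {F : Set X} (hF : IsClosed F)
    (hAF : A ⊆ F) : P Fᶜ = 0 := by
  obtain ⟨R, hR, h⟩ := hκ.exists_isProj hμ A
  rw [hκ.isProj_unique hP hR hμ]
  exact h F hF hAF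

lemma renergy_mono_set (hP : IsProj κ A μ P) (hR : IsProj κ B μ R) (hμ : μ ∈ Eplus κ)
    (h : A ⊆ B) : renergy κ μ P ≤ renergy κ μ R := by
  rw [hκ.comm hμ hP.mem, hκ.comm hμ hR.mem]
  exact hκ.renergy_le_of_ae_le hP.mem hR.mem hμ (Eventually.of_forall
    (hκ.pot_le hP hμ hR.mem fun ν hν => hR.le ν (mono_memOn hν h)))

lemma isProj_add (hU : IsProj κ A μ U) (hI : IsProj κ B μ I) (h : B ⊆ A) :
    IsProj κ A (U + I) (U + I) := by
  obtain ⟨u, hu, hulim⟩ := hU.approx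
  obtain ⟨v, hv, hvlim⟩ := hI.approx
  refine ⟨hκ.add_mem hU.mem hI.mem, ⟨fun n => u n + v n, fun n =>
    hκ.add_memOn (hu n) (mono_memOn (hv n) h), ?_⟩, fun _ _ => le_rfl, rfl⟩
  have h1 := (hulim.const_mul 2).add (hvlim.const_mul 2)
  rw [mul_zero, add_zero] at h1
  refine squeeze_zero (fun n => hκ.dist2_nonneg (hκ.add_mem (hu n).1 (hv n).1)
    (hκ.add_mem hU.mem hI.mem)) (fun n => ?_) h1
  have hun := (hu n).1
  have hvn := (hv n).1
  have hU' := hU.mem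
  have hI' := hI.mem
  have h2 := hκ.dist2_nonneg (hκ.add_mem hun hI') (hκ.add_mem hU' hvn)
  simp only [dist2] at h2 ⊢
  simp only [hκ.add_left, hκ.add_right, hκ.add_mem, hun, hvn, hU', hI'] at h2 ⊢
  rw [hκ.comm hI' hun, hκ.comm hI' hU', hκ.comm hvn hU', hκ.comm hI' hvn] at h2
  rw [hκ.comm hvn hun, hκ.comm hI' hU', hκ.comm hvn hU']
  linarith

lemma pot_union_add_inter (hμ : μ ∈ Eplus κ) (hA : MeasurableSet A) (hB : MeasurableSet B)
    (hP : IsProj κ A μ P) (hR : IsProj κ B μ R) (hU : IsProj κ (A ∪ B) μ U)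
    (hI : IsProj κ (A ∩ B) μ I) (x : X) :
    pot κ (U + I) x ≤ pot κ (P + R) x := by
  have hUI := hκ.add_mem hU.mem hI.mem
  have hPR := hκ.add_mem hP.mem hR.mem
  refine hκ.pot_le (hκ.isProj_add hU hI (inter_subset_left.trans subset_union_left)) hUI hPR
    (fun ν hν => hκ.renergy_le_of_ae_le hUI hPR hν.1 ?_) x
  have hUμ := hκ.pot_le_self hU hμ
  have hIP : ∀ x, pot κ I x ≤ pot κ P x :=
    hκ.pot_le hI hμ hP.mem fun ν hν => hP.le ν (mono_memOn hν inter_subset_left)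
  have hIR : ∀ x, pot κ I x ≤ pot κ R x :=
    hκ.pot_le hI hμ hR.mem fun ν hν => hR.le ν (mono_memOn hν inter_subset_right)
  have aux : ∀ {A P}, MeasurableSet A → IsProj κ A μ P →
      ∀ᵐ x ∂ν, x ∈ A → pot κ μ x ≤ pot κ P x := by
    intro A P hA hP
    rw [← ae_restrict_iff' hA]
    exact hκ.ae_pot_leOn hμ hP.mem hP.le (restrict_memOn hν.1 hA)
  have h0 : ∀ᵐ x ∂ν, x ∈ A ∪ B := (mem_EplusOn.1 hν).2
  filter_upwards [aux hA hP, aux hB hR, h0] with x hxA hxB hx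
  rw [pot_add, pot_add]
  rcases hx with hx | hx
  · exact add_le_add ((hUμ x).trans (hxA hx)) (hIR x)
  · rw [add_comm (pot κ P x)]
    exact add_le_add ((hUμ x).trans (hxB hx)) (hIP x)

theorem openCapacity (hμ : μ ∈ Eplus κ) {bal : Set X → Measure X}
    (hb : ∀ A, IsProj κ A μ (bal A)) : OpenCapacity fun A => renergy κ μ (bal A) where
  nonneg D := renergy_nonneg _ _
  mono D G _ _ h := hκ.renergy_mono_set (hb D) (hb G) hμ h
  union_add_inter D G hD hG := by
    have h := hκ.renergy_le_of_ae_le (hκ.add_mem (hb (D ∪ G)).mem (hb (D ∩ G)).mem)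
      (hκ.add_mem (hb D).mem (hb G).mem) hμ (Eventually.of_forall (hκ.pot_union_add_inter hμ
        hD.measurableSet hG.measurableSet (hb D) (hb G) (hb (D ∪ G)) (hb (D ∩ G))))
    simpa only [hκ.add_left (hb _).mem (hb _).mem hμ, hκ.comm (hb _).mem hμ] using h
  iUnion_le D c hD hDo hc := by
    obtain ⟨C, Q, hCA, hC, hQ, hQC, hlim⟩ := hκ.exists_compact_isProj hμ (hb (⋃ n, D n))
    refine le_of_tendsto' (hκ.tendsto_renergy (fun n => (hQ n).mem) (hb _).mem hlim hμ) fun k => ?_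
    obtain ⟨n, hn⟩ := (hC k).elim_directed_cover D hDo (hCA k) hD.directed_le
    exact (hκ.renergy_mono_set (hQ k) (hb (D n)) hμ hn).trans (hc n)

lemma exists_ne_zero_of_compact (hμ : μ ∈ Eplus κ) {bal : Set X → Measure X}
    (hb : ∀ A, IsProj κ A μ (bal A)) (hK : IsCompact K) {a : ℝ} (ha : 0 < a)
    (h : ∀ D, IsOpen D → K ⊆ D → a ≤ renergy κ μ (bal D)) : ∃ P ∈ EplusOn κ K, P ≠ 0 := by
  let := TopologicalSpace.metrizableSpaceMetric X
  let r : ℕ → ℝ := fun n => 1 / ((n : ℝ) + 1)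
  have hr : ∀ n, 0 < r n := fun n => Nat.one_div_pos_of_nat
  have hr' : ∀ {i j}, i ≤ j → r j ≤ r i := fun h => Nat.one_div_le_one_div h
  let D : ℕ → Set X := fun n => Metric.thickening (r n) K
  have hD : Antitone D := fun i j hij => Metric.thickening_mono (hr' hij) K
  let P : ℕ → Measure X := fun n => bal (D n)
  have hP : ∀ n, IsProj κ (D n) μ (P n) := fun n => hb (D n)
  have hd : ∀ {i j}, i ≤ j → dist2 κ (P i) (P j) = renergy κ μ (P i) - renergy κ μ (P j) := by
    intro i j hij
    rw [dist2, hκ.renergy_eq_of_isProj (hP i) hμ (hP j) (hD hij), (hP i).self, (hP j).self]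
    ring
  have hanti : Antitone fun n => renergy κ μ (P n) := fun i j hij =>
    hκ.renergy_mono_set (hP j) (hP i) hμ (hD hij)
  have hlim := tendsto_atTop_ciInf hanti ⟨0, by rintro _ ⟨n, rfl⟩; exact renergy_nonneg _ _⟩
  have hC := hlim.cauchySeq
  obtain ⟨R, hR, hPR, hsupp⟩ := hκ.complete (fun n => (hP n).mem) fun ε hε => by
    obtain ⟨N, hN⟩ := Metric.cauchySeq_iff.1 hC ε hε
    refine ⟨N, fun i hi j hj => ?_⟩
    have hij := hN i hi j hj
    rw [Real.dist_eq] at hij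
    rcases le_total i j with h' | h'
    · rw [hd h']
      exact (le_abs_self _).trans_lt hij
    · have e : dist2 κ (P i) (P j) = dist2 κ (P j) (P i) := by
        rw [dist2, dist2, hκ.comm (hP i).mem (hP j).mem]
        ring
      rw [e, hd h']
      rw [abs_sub_comm] at hij
      exact (le_abs_self _).trans_lt hij
  refine ⟨R, mem_EplusOn.2 ⟨hR, ?_⟩, ?_⟩
  · have hKr : K = ⋂ n, Metric.cthickening (r n) K := by
      refine Subset.antisymm (subset_iInter fun n => Metric.self_subset_cthickening K) ?_
      intro x hx
      rw [← hK.isClosed.closure_eq, Metric.closure_eq_iInter_cthickening]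
      refine mem_iInter₂.2 fun δ hδ => ?_
      obtain ⟨n, hn⟩ := exists_nat_one_div_lt hδ
      exact Metric.cthickening_mono hn.le K (mem_iInter.1 hx n)
    rw [hKr, compl_iInter]
    refine measure_iUnion_null fun n => hsupp _ Metric.isClosed_cthickening ?_
    filter_upwards [eventually_ge_atTop n] with i hi
    exact hκ.isProj_null (hP i) hμ Metric.isClosed_cthickening
      ((hD hi).trans (Metric.thickening_subset_cthickening _ _))
  · rintro rfl
    have h1 : a ≤ renergy κ (0 : Measure X) 0 :=
      ge_of_tendsto' (hκ.tendsto_self (fun n => (hP n).mem) hR hPR) fun n => by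
        rw [(hP n).self]
        exact h (D n) Metric.isOpen_thickening (Metric.self_subset_thickening (hr n) K)
    have h2 : renergy κ (0 : Measure X) 0 = 0 := by simp [renergy, energy]
    linarith

end Admissible

/-- `E` has open neighbourhoods `D` such that the mass of measures on `D` is arbitrarily small
relative to their energy norm. -/
def Negligible (κ : X → X → ℝ≥0∞) (E : Set X) : Prop :=
  ∀ ε : ℝ, 0 < ε → ∃ D, IsOpen D ∧ E ⊆ D ∧
    ∀ ν ∈ EplusOn κ D, ν univ ≤ ENNReal.ofReal (ε * Real.sqrt (renergy κ ν ν))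

lemma Negligible.outerCap_eq_zero (h : Negligible κ E) : outerCap κ E = 0 := by
  refine le_antisymm (le_of_forall_gt_imp_ge_of_dense fun c hc => ?_) zero_le
  obtain ⟨ε, hε, hεc⟩ : ∃ ε : ℝ, 0 < ε ∧ ENNReal.ofReal (ε ^ 2) ≤ c := by
    obtain ⟨δ, hδ, hδc⟩ := ENNReal.lt_iff_exists_nnreal_btwn.1 hc
    refine ⟨Real.sqrt δ, Real.sqrt_pos.2 (by exact_mod_cast hδ), ?_⟩
    rw [Real.sq_sqrt δ.coe_nonneg, ENNReal.ofReal_coe_nnreal]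
    exact hδc.le
  obtain ⟨D, hD, hED, hν⟩ := h ε hε
  refine (iInf₂_le D ⟨hD, hED⟩).trans (le_trans ?_ hεc)
  rw [innerCap, ENNReal.inv_le_iff_inv_le]
  refine le_iInf₂ fun ν ⟨hνD, h1⟩ => ?_
  have h2 := hν ν hνD
  rw [h1, ← ENNReal.ofReal_one, ENNReal.ofReal_le_ofReal_iff (by positivity)] at h2
  have h3 : energy κ ν ν = ENNReal.ofReal (renergy κ ν ν) :=
    (ENNReal.ofReal_toReal hνD.1.2.ne).symm
  rw [h3, ← ENNReal.ofReal_inv_of_pos (by positivity)]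
  refine ENNReal.ofReal_le_ofReal ?_
  rw [inv_le_iff_one_le_mul₀ (by positivity)]
  have h4 := Real.sq_sqrt (Admissible.renergy_nonneg (κ := κ) ν ν)
  calc (1 : ℝ) ≤ (ε * Real.sqrt (renergy κ ν ν)) ^ 2 := one_le_pow₀ h2
    _ = _ := by rw [mul_pow, h4]; ring

lemma Negligible.iUnion {E : ℕ → Set X} (h : ∀ n, Negligible κ (E n)) :
    Negligible κ (⋃ n, E n) := by
  intro ε hε
  choose D hD hED hν using fun n : ℕ => h n (ε / 2 / 2 ^ n) (by positivity)
  refine ⟨⋃ n, D n, isOpen_iUnion hD, iUnion_mono hED, fun ν hνD => ?_⟩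
  have h0 := (mem_EplusOn.1 hνD).2
  calc ν univ = ν (⋃ n, D n) := by
        rw [← add_zero (ν (⋃ n, D n)), ← h0,
          measure_add_measure_compl (isOpen_iUnion hD).measurableSet]
    _ ≤ ∑' n, ν (D n) := measure_iUnion_le D
    _ ≤ ∑' n, ENNReal.ofReal (ε / 2 / 2 ^ n * Real.sqrt (renergy κ ν ν)) := by
        refine ENNReal.tsum_le_tsum fun n => ?_
        have h1 := hν n _ (Admissible.restrict_memOn hνD.1 (hD n).measurableSet)
        rw [Measure.restrict_apply_univ] at h1
        refine h1.trans (ENNReal.ofReal_le_ofReal ?_)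
        gcongr
        exact Admissible.renergy_restrict_le hνD.1 _
    _ = _ := by
        rw [← ENNReal.ofReal_tsum_of_nonneg (fun n => by positivity)
          ((summable_geometric_two' ε).mul_right _), tsum_mul_right, tsum_geometric_two' ε]

namespace Admissible

variable (hκ : Admissible κ)
include hκ

lemma negligible_of_subset (hE : MeasurableSet E) (hE0 : innerCap κ E = 0) {U : Set X}
    (hK : IsCompact K) (hEK : E ⊆ K) (hU : IsOpen U) (hEU : E ⊆ U) (hμ : μ ∈ Eplus κ)
    (hμU : ∀ x ∈ U, 1 ≤ pot κ μ x) : Negligible κ E := by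
  intro ε hε
  choose bal hb _ using hκ.exists_isProj hμ
  have hΦ := hκ.openCapacity hμ hb
  have h0 : outerValue (fun A => renergy κ μ (bal A)) E ≤ 0 := by
    by_contra! hcon
    obtain ⟨a, ha, ha'⟩ := exists_between hcon
    obtain ⟨C, hCE, hC, hCa⟩ := hΦ.exists_compact_of_measurableSet hE hK hEK ha'
    obtain ⟨P, hP, hP0⟩ := hκ.exists_ne_zero_of_compact hμ hb hC ha hCa
    exact hP0 (innerCap_eq_zero_iff.1 hE0 P (mono_memOn hP hCE))
  obtain ⟨G, hG, hEG, hlt⟩ := OpenCapacity.exists_lt (h0.trans_lt (show 0 < ε ^ 2 by positivity))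
  refine ⟨G ∩ U, hG.inter hU, subset_inter hEG hEU, fun ν hν => ?_⟩
  have hνG := mono_memOn hν (inter_subset_left : G ∩ U ⊆ G)
  have h1 : ν univ ≤ energy κ ν μ := by
    have : ∀ᵐ x ∂ν, x ∈ G ∩ U := (mem_EplusOn.1 hν).2
    rw [← lintegral_one]
    exact lintegral_mono_ae (this.mono fun x hx => hμU x hx.2)
  have h2 : energy κ ν μ = ENNReal.ofReal (renergy κ (bal G) ν) := by
    rw [hκ.renergy_eq_of_memOn (hb G) hμ hνG, hκ.comm hμ hν.1, renergy,
      ENNReal.ofReal_toReal (hκ.energy_lt_top hν.1 hμ).ne]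
  rw [h2] at h1
  refine h1.trans (ENNReal.ofReal_le_ofReal ?_)
  have h3 := hκ.cauchy_schwarz (hb G).mem hν.1
  rw [(hb G).self] at h3
  have h4 := renergy_nonneg (κ := κ) ν ν
  refine le_of_sq_le_sq (h3.trans ?_) (by positivity)
  rw [mul_pow, Real.sq_sqrt h4]
  gcongr

theorem outerCap_eq_zero_iff (hE : MeasurableSet E) : outerCap κ E = 0 ↔ innerCap κ E = 0 := by
  constructor
  · intro h
    refine le_antisymm (le_trans (le_iInf₂ fun D hD => ?_) h.le) zero_le
    exact ENNReal.inv_le_inv.2 (iInf₂_mono' fun ν hν => ⟨ν, ⟨mono_memOn hν.1 hD.2, hν.2⟩, le_rfl⟩)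
  · intro h
    let C : CompactExhaustion X := default
    have : E = ⋃ n, E ∩ C n := by rw [← inter_iUnion, C.iUnion_eq, inter_univ]
    rw [this]
    refine (Negligible.iUnion fun n => ?_).outerCap_eq_zero
    obtain ⟨μ, hμ, hμ1⟩ := hκ.one_le _ (C.isCompact (n + 1))
    refine hκ.negligible_of_subset (hE.inter (C.isCompact n).measurableSet) ?_ (C.isCompact n)
      inter_subset_right isOpen_interior (inter_subset_right.trans (C.subset_interior_succ n)) hμ
      fun x hx => hμ1 x (interior_subset hx)
    rw [innerCap_eq_zero_iff] at h ⊢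
    exact fun ν hν => h ν (mono_memOn hν inter_subset_left)

lemma qeOn_iff (hB : MeasurableSet B) (hμ : μ ∈ Eplus κ) (hθ : θ ∈ Eplus κ) :
    QEOn κ B (fun x => pot κ μ x ≤ pot κ θ x) ↔ NEOn κ B (fun x => pot κ μ x ≤ pot κ θ x) := by
  have := hμ.1.2
  have := hθ.1.2
  exact hκ.outerCap_eq_zero_iff (hB.inter
    (measurableSet_le (hκ.ker.measurable_pot μ) (hκ.ker.measurable_pot θ)).compl)

theorem isOuterBal_iff (hB : MeasurableSet B) (hμ : μ ∈ Eplus κ) :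
    IsOuterBal κ B μ P ↔ IsInnerBal κ B μ P := by
  have : OuterLam κ B μ = InnerLam κ B μ := by
    ext ν
    exact and_congr_right fun hν => hκ.qeOn_iff hB hμ hν
  rw [IsOuterBal, IsInnerBal, this]

end Admissible

end BorelNull

section Separating

variable [SecondCountableTopology X]

lemma exists_integral_tendsto_measure {U K : Set X} (hU : IsOpen U) (hK : IsCompact K)
    (hUK : U ⊆ K) :
    ∃ g : ℕ → X → ℝ, (∀ n, Continuous (g n) ∧ HasCompactSupport (g n)) ∧
      ∀ μ : Measure X, IsLocallyFiniteMeasure μ →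
        Tendsto (fun n => ∫ x, g n x ∂μ) atTop (𝓝 (μ U).toReal) := by
  let := TopologicalSpace.metrizableSpaceMetric X
  let a := hU.isClosed_compl.apprSeq
  have ha1 : ∀ n x, a n x ≤ 1 := HasOuterApproxClosed.apprSeq_apply_le_one hU.isClosed_compl
  have hsupp : ∀ n, ∀ x ∉ K, 1 - (a n x : ℝ) = 0 := fun n x hx => by
    have : a n x = 1 := HasOuterApproxClosed.apprSeq_apply_eq_one hU.isClosed_compl n
      fun hxU => hx (hUK hxU)
    rw [this]
    simp
  refine ⟨fun n x => 1 - (a n x : ℝ), fun n => ⟨?_, HasCompactSupport.intro hK (hsupp n)⟩,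
    fun μ hμ => ?_⟩
  · exact continuous_const.sub (NNReal.continuous_coe.comp (a n).continuous)
  · have e : (μ U).toReal = ∫ x, U.indicator (fun _ => (1 : ℝ)) x ∂μ := by
      rw [integral_indicator hU.measurableSet]
      simp [Measure.real]
    rw [e]
    refine tendsto_integral_of_dominated_convergence (K.indicator fun _ => (1 : ℝ))
      (fun n => ?_) ?_ (fun n => ?_) ?_
    · exact (continuous_const.sub
        (NNReal.continuous_coe.comp (a n).continuous)).aestronglyMeasurable
    · exact (integrable_indicator_iff hK.measurableSet).2
        (integrableOn_const hK.measure_ne_top (by simp))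
    · refine Eventually.of_forall fun x => ?_
      by_cases hx : x ∈ K
      · rw [indicator_of_mem hx, Real.norm_eq_abs, abs_of_nonneg]
        · linarith [(a n x).coe_nonneg]
        · have : (a n x : ℝ) ≤ 1 := by exact_mod_cast ha1 n x
          linarith
      · rw [hsupp n x hx, indicator_of_notMem hx, norm_zero]
    · refine Eventually.of_forall fun x => ?_
      have h1 := tendsto_pi_nhds.1
        (HasOuterApproxClosed.tendsto_apprSeq hU.isClosed_compl) x
      have h2 := (NNReal.tendsto_coe.2 h1).const_sub 1
      convert h2 using 2
      by_cases hx : x ∈ U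
      · simp [hx]
      · simp [hx]

/-- On a second countable locally compact space, countably many continuous compactly supported
functions separate locally finite measures. -/
theorem exists_countable_separating :
    ∃ S : Set (X → ℝ), S.Countable ∧ (∀ f ∈ S, Continuous f ∧ HasCompactSupport f) ∧
      ∀ μ ν : Measure X, IsLocallyFiniteMeasure μ → IsLocallyFiniteMeasure ν →
        (∀ f ∈ S, ∫ x, f x ∂μ = ∫ x, f x ∂ν) → μ = ν := by
  let C : CompactExhaustion X := default
  let b := TopologicalSpace.countableBasis X
  have hbo : ∀ s : Finset b, IsOpen (⋂ i ∈ s, (i : Set X)) := fun s =>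
    isOpen_biInter_finset fun i _ => TopologicalSpace.isOpen_of_mem_countableBasis i.2
  let V : Finset b × ℕ → Set X := fun p => (⋂ i ∈ p.1, (i : Set X)) ∩ interior (C p.2)
  have hV : ∀ p, IsOpen (V p) := fun p => (hbo p.1).inter isOpen_interior
  have hVC : ∀ p, V p ⊆ C p.2 := fun p => inter_subset_right.trans interior_subset
  have : Countable b := TopologicalSpace.countable_countableBasis X
  choose g hg hlim using fun p => exists_integral_tendsto_measure (hV p) (C.isCompact p.2) (hVC p)
  refine ⟨range fun q : (Finset b × ℕ) × ℕ => g q.1 q.2, countable_range _, ?_, ?_⟩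
  · rintro _ ⟨q, rfl⟩
    exact hg q.1 q.2
  intro μ ν hμ hν h
  have hcover : ⋃ n, interior (C n) = univ := by
    refine eq_univ_of_forall fun x => ?_
    obtain ⟨n, hn⟩ := C.exists_mem x
    exact mem_iUnion.2 ⟨n + 1, C.subset_interior_succ n hn⟩
  refine Measure.ext_of_generateFrom_of_cover_subset (S := range V)
    (T := range fun n => V (∅, n)) ?_ ?_ ?_ (countable_range _) ?_ ?_ ?_
  · rw [BorelSpace.measurable_eq (α := X),
      (TopologicalSpace.isBasis_countableBasis X).borel_eq_generateFrom]
    refine le_antisymm (MeasurableSpace.generateFrom_le fun U hU => ?_)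
      (MeasurableSpace.generateFrom_le ?_)
    · have : U = ⋃ n, V ({⟨U, hU⟩}, n) := by
        simp only [V, Finset.mem_singleton, iInter_iInter_eq_left]
        rw [← inter_iUnion, hcover, inter_univ]
      rw [this]
      exact MeasurableSet.iUnion fun n => MeasurableSpace.measurableSet_generateFrom ⟨_, rfl⟩
    · rintro _ ⟨p, rfl⟩
      rw [← (TopologicalSpace.isBasis_countableBasis X).borel_eq_generateFrom,
        ← BorelSpace.measurable_eq (α := X)]
      exact (hV p).measurableSet
  · classical
    rintro _ ⟨⟨s, n⟩, rfl⟩ _ ⟨⟨t, m⟩, rfl⟩ -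
    refine ⟨(s ∪ t, min n m), ?_⟩
    have hmono : Monotone fun n => interior (C n) := fun i j hij => interior_mono (C.subset hij)
    have h1 : interior (C (min n m)) = interior (C n) ∩ interior (C m) := by
      rcases le_total n m with h | h
      · rw [min_eq_left h, inter_eq_left.2 (hmono h)]
      · rw [min_eq_right h, inter_eq_right.2 (hmono h)]
    ext x
    simp only [V, h1, mem_inter_iff, mem_iInter, Finset.mem_union]
    constructor
    · rintro ⟨h1, h2, h3⟩
      exact ⟨⟨fun i hi => h1 i (Or.inl hi), h2⟩, fun i hi => h1 i (Or.inr hi), h3⟩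
    · rintro ⟨⟨h1, h2⟩, h3, h4⟩
      exact ⟨fun i hi => hi.elim (h1 i) (h3 i), h2, h4⟩
  · rintro _ ⟨n, rfl⟩
    exact ⟨_, rfl⟩
  · rw [sUnion_range]
    simpa [V] using hcover
  · rintro _ ⟨n, rfl⟩
    exact (measure_mono (hVC _)).trans_lt (C.isCompact n).measure_lt_top |>.ne
  · rintro _ ⟨p, rfl⟩
    have hfin : ∀ ρ : Measure X, IsLocallyFiniteMeasure ρ → ρ (V p) ≠ ⊤ := fun ρ _ =>
      ((measure_mono (hVC p)).trans_lt (C.isCompact p.2).measure_lt_top).ne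
    rw [← ENNReal.toReal_eq_toReal_iff' (hfin μ hμ) (hfin ν hν)]
    refine tendsto_nhds_unique (hlim p μ hμ) ((hlim p ν hν).congr fun n => ?_)
    exact (h _ ⟨(p, n), rfl⟩).symm

lemma tendsto_integral_of_tendstoUniformly {g : ℕ → X → ℝ} {f : X → ℝ} {K : Set X}
    (hg : ∀ j, Continuous (g j)) (hgK : ∀ j, tsupport (g j) ⊆ K) (hK : IsCompact K)
    (hf : Continuous f) (hfs : HasCompactSupport f) (h : TendstoUniformly g f atTop)
    (μ : Measure X) [IsLocallyFiniteMeasure μ] :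
    Tendsto (fun j => ∫ x, g j x ∂μ) atTop (𝓝 (∫ x, f x ∂μ)) := by
  obtain ⟨M, hM⟩ := hfs.exists_bound_of_continuous hf
  refine tendsto_integral_filter_of_dominated_convergence (K.indicator fun _ => M + 1)
    (Eventually.of_forall fun j => (hg j).aestronglyMeasurable) ?_ ?_
    (Eventually.of_forall fun x => h.tendsto_at x)
  · filter_upwards [Metric.tendstoUniformly_iff.1 h 1 one_pos] with j hj
    refine Eventually.of_forall fun x => ?_
    by_cases hx : x ∈ K
    · rw [indicator_of_mem hx]
      have h1 := hj x
      rw [dist_eq_norm, norm_sub_rev] at h1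
      have h2 := norm_sub_norm_le (g j x) (f x)
      linarith [hM x]
    · rw [indicator_of_notMem hx, image_eq_zero_of_notMem_tsupport fun h' => hx (hgK j h'),
        norm_zero]
  · exact (integrable_indicator_iff hK.measurableSet).2
      (integrableOn_const hK.measure_ne_top (by simp))

variable {κ : X → X → ℝ≥0∞} {lp lm ξ : Measure X}

lemma Admissible.integral_spot (hκ : Admissible κ) (hlp : lp ∈ Eplus κ) (hlm : lm ∈ Eplus κ)
    (hξ : ξ ∈ Eplus κ) :
    ∫ x, spot κ lp lm x ∂ξ = (energy κ ξ lp).toReal - (energy κ ξ lm).toReal := by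
  have h : ∀ l ∈ Eplus κ, Integrable (fun x => (pot κ l x).toReal) ξ ∧
      ∫ x, (pot κ l x).toReal ∂ξ = (energy κ ξ l).toReal := by
    intro l hl
    have := hl.1.2
    have hm := (hκ.ker.measurable_pot l).aemeasurable (μ := ξ)
    have hfin := (hκ.energy_lt_top hξ hl).ne
    exact ⟨integrable_toReal_of_lintegral_ne_top hm hfin,
      integral_toReal hm (ae_lt_top' hm hfin)⟩
  rw [← (h lp hlp).2, ← (h lm hlm).2]
  exact integral_sub (h lp hlp).1 (h lm hlm).1

lemma A2.one_le (hA2 : A2 κ) {K : Set X} (hK : IsCompact K) :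
    ∃ μ ∈ Eplus κ, ∀ x ∈ K, 1 ≤ pot κ μ x := by
  obtain ⟨f, hf1, -, hfs, -⟩ := exists_continuous_one_zero_of_isCompact hK isClosed_empty
    (disjoint_empty K)
  obtain ⟨-, lp, lm, -, -, hl, -, -, -, hlim⟩ := hA2 (fun x => 2 * f x) (by fun_prop)
    (hfs.mul_left (f := fun _ => (2 : ℝ)))
  obtain ⟨j, hj⟩ := (Metric.tendstoUniformly_iff.1 hlim 1 one_pos).exists
  refine ⟨lp j, (hl j).1, fun x hx => ?_⟩
  have h1 := hj x
  rw [Real.dist_eq, hf1 hx, Pi.one_apply, mul_one, abs_lt] at h1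
  have h2 : 1 ≤ (pot κ (lp j) x).toReal := by
    have : 0 ≤ (pot κ (lm j) x).toReal := ENNReal.toReal_nonneg
    have h3 := h1.2
    rw [spot] at h3
    linarith
  rw [← ENNReal.ofReal_one]
  exact ENNReal.ofReal_le_of_le_toReal h2

/-- Countably many signed measures of finite energy separate the points of `E⁺`. -/
theorem Admissible.exists_countable_energy_separating (hκ : Admissible κ) (hA2 : A2 κ) :
    ∃ L : Set (Measure X × Measure X), L.Countable ∧
      (∀ l ∈ L, l.1 ∈ Eplus κ ∧ l.2 ∈ Eplus κ) ∧
      ∀ ξ ∈ Eplus κ, ∀ ζ ∈ Eplus κ,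
        (∀ l ∈ L, (energy κ ξ l.1).toReal - (energy κ ξ l.2).toReal
          = (energy κ ζ l.1).toReal - (energy κ ζ l.2).toReal) → ξ = ζ := by
  obtain ⟨S, hS, hSc, hSsep⟩ := exists_countable_separating (X := X)
  choose! K lp lm hK using hA2
  refine ⟨⋃ f ∈ S, range fun j => (lp f j, lm f j), hS.biUnion fun _ _ => countable_range _,
    fun l hl => ?_, fun ξ hξ ζ hζ h => ?_⟩
  · obtain ⟨f, hf, j, rfl⟩ := mem_iUnion₂.1 hl
    exact (hK f (hSc f hf).1 (hSc f hf).2).2.2.1 j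
  · refine hSsep ξ ζ hξ.1.2 hζ.1.2 fun f hf => ?_
    have := hξ.1.2
    have := hζ.1.2
    obtain ⟨hf1, hf2⟩ := hSc f hf
    obtain ⟨hKc, -, hl, -, hcont, hsupp, hlim⟩ := hK f hf1 hf2
    have h1 := tendsto_integral_of_tendstoUniformly hcont hsupp hKc hf1 hf2 hlim ξ
    have h2 := tendsto_integral_of_tendstoUniformly hcont hsupp hKc hf1 hf2 hlim ζ
    refine tendsto_nhds_unique h1 (h2.congr fun j => ?_)
    rw [hκ.integral_spot (hl j).1 (hl j).2 hξ, hκ.integral_spot (hl j).1 (hl j).2 hζ]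
    exact (h _ (mem_iUnion₂.2 ⟨f, hf, j, rfl⟩)).symm

end Separating

/-- A countable family `Λ°` of signed measures of finite energy, depending only on `X`
and `κ`, such that the symmetry relations `κ(μ^A,λ) = κ(λ^A,μ)`, `λ ∈ Λ°`, hold and
determine the inner balayage uniquely; analogously for outer balayage to Borel sets. -/
theorem statement6 [SecondCountableTopology X] (κ : X → X → ℝ≥0∞) (hker : IsKernel κ)
    (hE : EnergyPrinciple κ) (hC : Consistent κ) (hD : Domination κ) (hA2 : A2 κ) :
    ∃ L : Set (Measure X × Measure X), L.Countable ∧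
      (∀ l ∈ L, l.1 ∈ Eplus κ ∧ l.2 ∈ Eplus κ) ∧
      (∀ A : Set X, ∀ μ ∈ Eplus κ, ∀ bμ : Measure X, IsInnerBal κ A μ bμ →
        (∀ l ∈ L, ∀ bp bm : Measure X, IsInnerBal κ A l.1 bp → IsInnerBal κ A l.2 bm →
          (energy κ bμ l.1).toReal - (energy κ bμ l.2).toReal
            = (energy κ bp μ).toReal - (energy κ bm μ).toReal) ∧
        (∀ ξ ∈ Eplus κ,
          (∀ l ∈ L, ∀ bp bm : Measure X, IsInnerBal κ A l.1 bp → IsInnerBal κ A l.2 bm →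
            (energy κ ξ l.1).toReal - (energy κ ξ l.2).toReal
              = (energy κ bp μ).toReal - (energy κ bm μ).toReal) → ξ = bμ)) ∧
      (∀ B : Set X, MeasurableSet B → ∀ μ ∈ Eplus κ, ∀ bμ : Measure X, IsOuterBal κ B μ bμ →
        (∀ l ∈ L, ∀ bp bm : Measure X, IsOuterBal κ B l.1 bp → IsOuterBal κ B l.2 bm →
          (energy κ bμ l.1).toReal - (energy κ bμ l.2).toReal
            = (energy κ bp μ).toReal - (energy κ bm μ).toReal) ∧
        (∀ ξ ∈ Eplus κ,
          (∀ l ∈ L, ∀ bp bm : Measure X, IsOuterBal κ B l.1 bp → IsOuterBal κ B l.2 bm →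
            (energy κ ξ l.1).toReal - (energy κ ξ l.2).toReal
              = (energy κ bp μ).toReal - (energy κ bm μ).toReal) → ξ = bμ)) := by
  have hκ : Admissible κ := ⟨hker, hE, hC, hD, fun K hK => hA2.one_le hK⟩
  obtain ⟨L, hL, hLE, hsep⟩ := hκ.exists_countable_energy_separating hA2
  have inner : ∀ A : Set X, ∀ μ ∈ Eplus κ, ∀ bμ : Measure X, IsInnerBal κ A μ bμ →
      (∀ l ∈ L, ∀ bp bm : Measure X, IsInnerBal κ A l.1 bp → IsInnerBal κ A l.2 bm →
        (energy κ bμ l.1).toReal - (energy κ bμ l.2).toReal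
          = (energy κ bp μ).toReal - (energy κ bm μ).toReal) ∧
      (∀ ξ ∈ Eplus κ,
        (∀ l ∈ L, ∀ bp bm : Measure X, IsInnerBal κ A l.1 bp → IsInnerBal κ A l.2 bm →
          (energy κ ξ l.1).toReal - (energy κ ξ l.2).toReal
            = (energy κ bp μ).toReal - (energy κ bm μ).toReal) → ξ = bμ) := by
    intro A μ hμ bμ hb
    have rel : ∀ l ∈ L, ∀ bp bm : Measure X, IsInnerBal κ A l.1 bp → IsInnerBal κ A l.2 bm →
        (energy κ bμ l.1).toReal - (energy κ bμ l.2).toReal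
          = (energy κ bp μ).toReal - (energy κ bm μ).toReal := by
      intro l hl bp bm hp hm
      rw [hκ.isInnerBal_iff hμ] at hb
      rw [hκ.isInnerBal_iff (hLE l hl).1] at hp
      rw [hκ.isInnerBal_iff (hLE l hl).2] at hm
      exact congrArg₂ (· - ·) (hκ.renergy_isProj_comm hb hμ hp (hLE l hl).1)
        (hκ.renergy_isProj_comm hb hμ hm (hLE l hl).2)
    refine ⟨rel, fun ξ hξ h => hsep ξ hξ bμ hb.1.1 fun l hl => ?_⟩
    obtain ⟨bp, hp, -⟩ := hκ.exists_isProj (hLE l hl).1 A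
    obtain ⟨bm, hm, -⟩ := hκ.exists_isProj (hLE l hl).2 A
    rw [← hκ.isInnerBal_iff (hLE l hl).1] at hp
    rw [← hκ.isInnerBal_iff (hLE l hl).2] at hm
    rw [h l hl bp bm hp hm, rel l hl bp bm hp hm]
  refine ⟨L, hL, hLE, inner, fun B hB μ hμ bμ hb => ?_⟩
  obtain ⟨h1, h2⟩ := inner B μ hμ bμ ((hκ.isOuterBal_iff hB hμ).1 hb)
  refine ⟨fun l hl bp bm hp hm => h1 l hl bp bm ((hκ.isOuterBal_iff hB (hLE l hl).1).1 hp)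
    ((hκ.isOuterBal_iff hB (hLE l hl).2).1 hm), fun ξ hξ h => h2 ξ hξ fun l hl bp bm hp hm =>
    h l hl bp bm ((hκ.isOuterBal_iff hB (hLE l hl).1).2 hp)
      ((hκ.isOuterBal_iff hB (hLE l hl).2).2 hm)⟩

end Balayage
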